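/- (One-step contraction of gradient descent.) Let α > 0, suppose K ∈ 𝕂_α, and let K' = K − η∇C(K) with step size 0 < η ≤ 1/L(α). Then C(K') − C(K*) ≤ (1 − 2μ²Λ_min(R)η/‖𝐗^{K*}‖_max)·(C(K) − C(K*)). -/

import Mathlib

open Matrix Filter
open scoped Kronecker Topology

namespace MJLS

noncomputable section

attribute [local instance] Classical.propDecidable

/-- Closed-loop matrices `Γ i = A i - B i * K i`. -/
def Gam {d k N : ℕ} (A : Fin N → Matrix (Fin d) (Fin d) ℝ)
    (B : Fin N → Matrix (Fin d) (Fin k) ℝ)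
    (K : Fin N → Matrix (Fin k) (Fin d) ℝ) : Fin N → Matrix (Fin d) (Fin d) ℝ :=
  fun i => A i - B i * K i

/-- The operator `E_i(V) = ∑ j, p i j • V j`. -/
def opE {d N : ℕ} (Pr : Matrix (Fin N) (Fin N) ℝ)
    (V : Fin N → Matrix (Fin d) (Fin d) ℝ) : Fin N → Matrix (Fin d) (Fin d) ℝ :=
  fun i => ∑ j, Pr i j • V j

/-- The matrix `𝒜 = diag(Γᵀ ⊗ Γᵀ) (P ⊗ I)`. -/
def calA {d N : ℕ} (Pr : Matrix (Fin N) (Fin N) ℝ)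
    (Γ : Fin N → Matrix (Fin d) (Fin d) ℝ) :
    Matrix (Fin N × Fin d × Fin d) (Fin N × Fin d × Fin d) ℝ :=
  (Matrix.reindex (Equiv.prodComm (Fin d × Fin d) (Fin N))
      (Equiv.prodComm (Fin d × Fin d) (Fin N))
      (Matrix.blockDiagonal fun i => (Γ i)ᵀ ⊗ₖ (Γ i)ᵀ)) *
    (Pr ⊗ₖ (1 : Matrix (Fin d × Fin d) (Fin d × Fin d) ℝ))

/-- `K` is mean-square stabilizing: the spectral radius of `𝒜` is less than `1`. -/
def MSS {d k N : ℕ} (Pr : Matrix (Fin N) (Fin N) ℝ)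
    (A : Fin N → Matrix (Fin d) (Fin d) ℝ) (B : Fin N → Matrix (Fin d) (Fin k) ℝ)
    (K : Fin N → Matrix (Fin k) (Fin d) ℝ) : Prop :=
  spectralRadius ℂ ((calA Pr (Gam A B K)).map (algebraMap ℝ ℂ)) < 1

/-- `P` solves the coupled Lyapunov equations for the policy `K`. -/
def IsLyap {d k N : ℕ} (Pr : Matrix (Fin N) (Fin N) ℝ)
    (A : Fin N → Matrix (Fin d) (Fin d) ℝ) (B : Fin N → Matrix (Fin d) (Fin k) ℝ)
    (Q : Fin N → Matrix (Fin d) (Fin d) ℝ) (R : Fin N → Matrix (Fin k) (Fin k) ℝ)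
    (K : Fin N → Matrix (Fin k) (Fin d) ℝ)
    (P : Fin N → Matrix (Fin d) (Fin d) ℝ) : Prop :=
  ∀ i, P i = Q i + (K i)ᵀ * R i * K i + (Gam A B K i)ᵀ * opE Pr P i * Gam A B K i

/-- `P^K`, the (for mean-square stabilizing `K`, unique) solution of the coupled
Lyapunov equations. -/
def PK {d k N : ℕ} (Pr : Matrix (Fin N) (Fin N) ℝ)
    (A : Fin N → Matrix (Fin d) (Fin d) ℝ) (B : Fin N → Matrix (Fin d) (Fin k) ℝ)
    (Q : Fin N → Matrix (Fin d) (Fin d) ℝ) (R : Fin N → Matrix (Fin k) (Fin k) ℝ)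
    (K : Fin N → Matrix (Fin k) (Fin d) ℝ) : Fin N → Matrix (Fin d) (Fin d) ℝ :=
  if h : ∃ P, IsLyap Pr A B Q R K P then h.choose else 0

/-- The LQR cost `C(K) = ∑ i, π i * tr(P^K_i Sg)`. -/
def cost {d k N : ℕ} (Pr : Matrix (Fin N) (Fin N) ℝ)
    (A : Fin N → Matrix (Fin d) (Fin d) ℝ) (B : Fin N → Matrix (Fin d) (Fin k) ℝ)
    (Q : Fin N → Matrix (Fin d) (Fin d) ℝ) (R : Fin N → Matrix (Fin k) (Fin k) ℝ)
    (piv : Fin N → ℝ) (Sg : Matrix (Fin d) (Fin d) ℝ)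
    (K : Fin N → Matrix (Fin k) (Fin d) ℝ) : ℝ :=
  ∑ i, piv i * (PK Pr A B Q R K i * Sg).trace

/-- The operator `T_j(V) = ∑ i, p i j • (Γ i * V i * Γ iᵀ)`. -/
def opT {d N : ℕ} (Pr : Matrix (Fin N) (Fin N) ℝ)
    (Γ : Fin N → Matrix (Fin d) (Fin d) ℝ)
    (V : Fin N → Matrix (Fin d) (Fin d) ℝ) : Fin N → Matrix (Fin d) (Fin d) ℝ :=
  fun j => ∑ i, Pr i j • (Γ i * V i * (Γ i)ᵀ)

/-- `𝐗^K = ∑_{t=0}^∞ T^t(X(0))` with `X_i(0) = π i • Sg`. -/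
def XK {d N : ℕ} (Pr : Matrix (Fin N) (Fin N) ℝ) (piv : Fin N → ℝ)
    (Sg : Matrix (Fin d) (Fin d) ℝ) (Γ : Fin N → Matrix (Fin d) (Fin d) ℝ) :
    Fin N → Matrix (Fin d) (Fin d) ℝ :=
  ∑' t : ℕ, (opT Pr Γ)^[t] (fun i => piv i • Sg)

/-- `L^K_i = (R i + B iᵀ E_i(P^K) B i) K i - B iᵀ E_i(P^K) A i`. -/
def LK {d k N : ℕ} (Pr : Matrix (Fin N) (Fin N) ℝ)
    (A : Fin N → Matrix (Fin d) (Fin d) ℝ) (B : Fin N → Matrix (Fin d) (Fin k) ℝ)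
    (Q : Fin N → Matrix (Fin d) (Fin d) ℝ) (R : Fin N → Matrix (Fin k) (Fin k) ℝ)
    (K : Fin N → Matrix (Fin k) (Fin d) ℝ) : Fin N → Matrix (Fin k) (Fin d) ℝ :=
  fun i => (R i + (B i)ᵀ * opE Pr (PK Pr A B Q R K) i * B i) * K i
    - (B i)ᵀ * opE Pr (PK Pr A B Q R K) i * A i

/-- The operator `L_i(V) = Γ iᵀ E_i(V) Γ i`. -/
def opL {d N : ℕ} (Pr : Matrix (Fin N) (Fin N) ℝ)
    (Γ : Fin N → Matrix (Fin d) (Fin d) ℝ)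
    (V : Fin N → Matrix (Fin d) (Fin d) ℝ) : Fin N → Matrix (Fin d) (Fin d) ℝ :=
  fun i => (Γ i)ᵀ * opE Pr V i * Γ i

/-- `(P^K)'[E] = ∑_{t=0}^∞ L^t(Eᵀ L^K + (L^K)ᵀ E)`. -/
def PKd {d k N : ℕ} (Pr : Matrix (Fin N) (Fin N) ℝ)
    (Γ : Fin N → Matrix (Fin d) (Fin d) ℝ)
    (Lk E : Fin N → Matrix (Fin k) (Fin d) ℝ) : Fin N → Matrix (Fin d) (Fin d) ℝ :=
  ∑' t : ℕ, (opL Pr Γ)^[t] (fun i => (E i)ᵀ * Lk i + (Lk i)ᵀ * E i)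

/-- `‖V‖₂² = ∑ i, tr(V iᵀ V i)`. -/
def norm2sq {a b N : ℕ} (V : Fin N → Matrix (Fin a) (Fin b) ℝ) : ℝ :=
  ∑ i, ((V i)ᵀ * V i).trace

/-- The inner product `⟨V, S⟩ = ∑ i, tr(V iᵀ S i)`. -/
def ip {a b N : ℕ} (V S : Fin N → Matrix (Fin a) (Fin b) ℝ) : ℝ :=
  ∑ i, ((V i)ᵀ * S i).trace

/-- The spectral norm (maximal singular value) of a matrix. -/
def specNorm {a b : ℕ} (M : Matrix (Fin a) (Fin b) ℝ) : ℝ :=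
  ⨆ x : {x : EuclideanSpace ℝ (Fin b) // ‖x‖ ≤ 1}, ‖Matrix.toEuclideanLin M x.1‖

/-- The minimal singular value of a square matrix. -/
def sigmaMin {a : ℕ} (M : Matrix (Fin a) (Fin a) ℝ) : ℝ :=
  ⨅ x : {x : EuclideanSpace ℝ (Fin a) // ‖x‖ = 1}, ‖Matrix.toEuclideanLin M x.1‖

/-- `‖V‖_max = max_i ‖V i‖` (spectral norms). -/
def maxNorm {a b N : ℕ} (V : Fin N → Matrix (Fin a) (Fin b) ℝ) : ℝ :=
  ⨆ i, specNorm (V i)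

/-- `Λ_min(V) = min_i σ_min(V i)`. -/
def lamMin {a N : ℕ} (V : Fin N → Matrix (Fin a) (Fin a) ℝ) : ℝ :=
  ⨅ i, sigmaMin (V i)

/-- `μ = (min_i π i) · σ_min(Sg)`. -/
def mu {d N : ℕ} (piv : Fin N → ℝ) (Sg : Matrix (Fin d) (Fin d) ℝ) : ℝ :=
  (⨅ i, piv i) * sigmaMin Sg

/-- `ξ(α) = (1/Λ_min(Q))·((1 + ‖B‖²_max)·α/μ + ‖R‖_max) − 1`. -/
def xi {d k N : ℕ} (B : Fin N → Matrix (Fin d) (Fin k) ℝ)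
    (R : Fin N → Matrix (Fin k) (Fin k) ℝ) (Q : Fin N → Matrix (Fin d) (Fin d) ℝ)
    (piv : Fin N → ℝ) (Sg : Matrix (Fin d) (Fin d) ℝ) (α : ℝ) : ℝ :=
  (1 / lamMin Q) * ((1 + maxNorm B ^ 2) * α / mu piv Sg + maxNorm R) - 1

/-- The smoothness constant
`L(α) = 2·(‖R‖_max + ‖B‖²_max·(1 + 2ξ(α)/‖B‖_max)·α/μ)·α/Λ_min(Q)`. -/
def Lsm {d k N : ℕ} (B : Fin N → Matrix (Fin d) (Fin k) ℝ)
    (R : Fin N → Matrix (Fin k) (Fin k) ℝ) (Q : Fin N → Matrix (Fin d) (Fin d) ℝ)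
    (piv : Fin N → ℝ) (Sg : Matrix (Fin d) (Fin d) ℝ) (α : ℝ) : ℝ :=
  2 * (maxNorm R + maxNorm B ^ 2 * (1 + 2 * xi B R Q piv Sg α / maxNorm B)
      * α / mu piv Sg) * α / lamMin Q

end

attribute [local instance] Matrix.normedAddCommGroup Matrix.normedSpace

/-- Real symmetric positive semidefinite matrices, via dot products. -/
def PSD {a : ℕ} (M : Matrix (Fin a) (Fin a) ℝ) : Prop :=
  Mᵀ = M ∧ ∀ x : Fin a → ℝ, 0 ≤ x ⬝ᵥ M *ᵥ x

lemma PSD.posSemidef {a : ℕ} {M : Matrix (Fin a) (Fin a) ℝ} (h : PSD M) : M.PosSemidef := by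
  refine PosSemidef.of_dotProduct_mulVec_nonneg ?_ ?_
  · rw [Matrix.IsHermitian, conjTranspose_eq_transpose_of_trivial]; exact h.1
  · intro x; simpa using h.2 x

lemma psd_of_posSemidef {a : ℕ} {M : Matrix (Fin a) (Fin a) ℝ} (h : M.PosSemidef) : PSD M := by
  refine ⟨?_, fun x => ?_⟩
  · have := h.1; rw [Matrix.IsHermitian, conjTranspose_eq_transpose_of_trivial] at this; exact this
  · simpa using h.dotProduct_mulVec_nonneg x

lemma quad_conj {a b : ℕ} (M : Matrix (Fin a) (Fin a) ℝ) (Y Z : Matrix (Fin a) (Fin b) ℝ)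
    (x y : Fin b → ℝ) : x ⬝ᵥ (Yᵀ * M * Z) *ᵥ y = (Y *ᵥ x) ⬝ᵥ M *ᵥ (Z *ᵥ y) := by
  rw [← mulVec_mulVec, ← mulVec_mulVec, dotProduct_mulVec, vecMul_transpose]

lemma quad_mul {a b : ℕ} (Y Z : Matrix (Fin a) (Fin b) ℝ)
    (x y : Fin b → ℝ) : x ⬝ᵥ (Yᵀ * Z) *ᵥ y = (Y *ᵥ x) ⬝ᵥ (Z *ᵥ y) := by
  rw [← mulVec_mulVec, dotProduct_mulVec, vecMul_transpose]

lemma quad_symm {a : ℕ} {M : Matrix (Fin a) (Fin a) ℝ} (h : Mᵀ = M) (x y : Fin a → ℝ) :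
    x ⬝ᵥ M *ᵥ y = y ⬝ᵥ M *ᵥ x := by
  rw [dotProduct_mulVec, ← mulVec_transpose, h, dotProduct_comm]

lemma PSD.conj {a b : ℕ} {M : Matrix (Fin a) (Fin a) ℝ} (h : PSD M) (Y : Matrix (Fin a) (Fin b) ℝ) :
    PSD (Yᵀ * M * Y) := by
  refine ⟨?_, fun x => ?_⟩
  · simp [transpose_mul, h.1, Matrix.mul_assoc]
  · rw [quad_conj]; exact h.2 _

lemma PSD.add {a : ℕ} {M M' : Matrix (Fin a) (Fin a) ℝ} (h : PSD M) (h' : PSD M') :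
    PSD (M + M') := by
  refine ⟨by rw [transpose_add, h.1, h'.1], fun x => ?_⟩
  rw [add_mulVec, dotProduct_add]; exact add_nonneg (h.2 x) (h'.2 x)

lemma PSD.smul {a : ℕ} {M : Matrix (Fin a) (Fin a) ℝ} (h : PSD M) {c : ℝ} (hc : 0 ≤ c) :
    PSD (c • M) := by
  refine ⟨by rw [transpose_smul, h.1], fun x => ?_⟩
  rw [smul_mulVec, dotProduct_smul]; exact mul_nonneg hc (h.2 x)

lemma psd_zero {a : ℕ} : PSD (0 : Matrix (Fin a) (Fin a) ℝ) := by
  refine ⟨by simp, fun x => by simp⟩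

lemma psd_sum {a : ℕ} {ι : Type*} (s : Finset ι) (f : ι → Matrix (Fin a) (Fin a) ℝ)
    (h : ∀ i ∈ s, PSD (f i)) : PSD (∑ i ∈ s, f i) := by
  classical
  induction s using Finset.induction_on with
  | empty => simpa using psd_zero
  | insert i s hi ih =>
    rw [Finset.sum_insert hi]
    exact (h i (by simp)).add (ih fun j hj => h j (by simp [hj]))

lemma isClosed_psd {a : ℕ} : IsClosed {M : Matrix (Fin a) (Fin a) ℝ | PSD M} := by
  have : {M : Matrix (Fin a) (Fin a) ℝ | PSD M} =
      {M | Mᵀ = M} ∩ ⋂ x : Fin a → ℝ, {M | 0 ≤ x ⬝ᵥ M *ᵥ x} := by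
    ext M; simp [PSD]
  rw [this]
  refine IsClosed.inter (isClosed_eq (by fun_prop) (by fun_prop)) (isClosed_iInter fun x => ?_)
  refine isClosed_le continuous_const ?_
  simp only [dotProduct, mulVec]
  fun_prop

open scoped MatrixOrder Matrix.Norms.L2Operator in
lemma PSD.factor {a : ℕ} {X : Matrix (Fin a) (Fin a) ℝ} (hX : PSD X) :
    ∃ Y : Matrix (Fin a) (Fin a) ℝ, X = Yᵀ * Y := by
  obtain ⟨Y, hY⟩ := CStarAlgebra.nonneg_iff_eq_star_mul_self.mp hX.posSemidef.nonneg
  refine ⟨Y, ?_⟩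
  rw [hY, star_eq_conjTranspose, conjTranspose_eq_transpose_of_trivial]

lemma trace_mul_nonneg {a : ℕ} {X M : Matrix (Fin a) (Fin a) ℝ} (hX : PSD X)
    (hM : ∀ x : Fin a → ℝ, 0 ≤ x ⬝ᵥ M *ᵥ x) : 0 ≤ (X * M).trace := by
  obtain ⟨Y, hY⟩ := hX.factor
  have : (X * M).trace = ∑ i, (Y i) ⬝ᵥ M *ᵥ (Y i) := by
    rw [hY, Matrix.mul_assoc, trace_mul_comm, trace]
    refine Finset.sum_congr rfl fun i _ => ?_
    rw [diag_apply, Matrix.mul_assoc, mul_apply']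
    rfl
  rw [this]
  exact Finset.sum_nonneg fun i _ => hM _

lemma trace_mul_mono {a : ℕ} {X M M' : Matrix (Fin a) (Fin a) ℝ} (hX : PSD X)
    (hM : ∀ x : Fin a → ℝ, x ⬝ᵥ M *ᵥ x ≤ x ⬝ᵥ M' *ᵥ x) : (X * M).trace ≤ (X * M').trace := by
  have := trace_mul_nonneg (M := M' - M) hX fun x => by
    rw [sub_mulVec, dotProduct_sub]; linarith [hM x]
  rw [Matrix.mul_sub, trace_sub] at this
  linarith

/-- The trace pairing. -/
noncomputable def pair {a N : ℕ} (V W : Fin N → Matrix (Fin a) (Fin a) ℝ) : ℝ :=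
  ∑ i, (V i * W i).trace

lemma pair_add_left {a N : ℕ} (V V' W : Fin N → Matrix (Fin a) (Fin a) ℝ) :
    pair (V + V') W = pair V W + pair V' W := by
  simp [pair, Matrix.add_mul, Finset.sum_add_distrib]

lemma pair_add_right {a N : ℕ} (V W W' : Fin N → Matrix (Fin a) (Fin a) ℝ) :
    pair V (W + W') = pair V W + pair V W' := by
  simp [pair, Matrix.mul_add, Finset.sum_add_distrib]

lemma pair_smul_right {a N : ℕ} (c : ℝ) (V W : Fin N → Matrix (Fin a) (Fin a) ℝ) :
    pair V (c • W) = c * pair V W := by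
  simp [pair, Finset.mul_sum]

lemma pair_mono {a N : ℕ} {X M M' : Fin N → Matrix (Fin a) (Fin a) ℝ} (hX : ∀ i, PSD (X i))
    (hM : ∀ i, ∀ x : Fin a → ℝ, x ⬝ᵥ M i *ᵥ x ≤ x ⬝ᵥ M' i *ᵥ x) : pair X M ≤ pair X M' :=
  Finset.sum_le_sum fun i _ => trace_mul_mono (hX i) (hM i)

/-- Elementary bound for bilinear forms. -/
lemma bil_bound {a : ℕ} (M : Matrix (Fin a) (Fin a) ℝ) (x y : Fin a → ℝ) :
    |x ⬝ᵥ M *ᵥ y| ≤ (∑ i, ∑ j, |M i j|) * ((x ⬝ᵥ x + y ⬝ᵥ y) / 2) := by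
  have h1 : ∀ (z : Fin a → ℝ) i, z i * z i ≤ z ⬝ᵥ z := fun z i =>
    Finset.single_le_sum (f := fun i => z i * z i) (fun j _ => mul_self_nonneg _) (Finset.mem_univ i)
  have : x ⬝ᵥ M *ᵥ y = ∑ i, ∑ j, M i j * (x i * y j) := by
    simp only [dotProduct, mulVec, Finset.mul_sum]
    refine Finset.sum_congr rfl fun i _ => Finset.sum_congr rfl fun j _ => by ring
  rw [this, Finset.sum_mul]
  refine (Finset.abs_sum_le_sum_abs _ _).trans (Finset.sum_le_sum fun i _ => ?_)
  rw [Finset.sum_mul]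
  refine (Finset.abs_sum_le_sum_abs _ _).trans (Finset.sum_le_sum fun j _ => ?_)
  rw [abs_mul]
  refine mul_le_mul_of_nonneg_left ?_ (abs_nonneg _)
  rw [abs_le]
  constructor <;> nlinarith [h1 x i, h1 y j, sq_nonneg (x i + y j), sq_nonneg (x i - y j)]

lemma quad_le_trace {a : ℕ} {M : Matrix (Fin a) (Fin a) ℝ} (hM : PSD M) (x : Fin a → ℝ) :
    x ⬝ᵥ M *ᵥ x ≤ M.trace * (x ⬝ᵥ x) := by
  have h := trace_mul_nonneg (X := M) (M := (x ⬝ᵥ x) • 1 - vecMulVec x x) hM (by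
    intro y
    rw [sub_mulVec, dotProduct_sub, smul_mulVec, one_mulVec, dotProduct_smul, vecMulVec_mulVec]
    simp only [smul_eq_mul, op_smul_eq_smul, dotProduct_smul]
    have := Finset.sum_mul_sq_le_sq_mul_sq Finset.univ x y
    simp only [dotProduct]
    simp only [pow_two] at this
    have e : (∑ i, y i * x i) = ∑ i, x i * y i := Finset.sum_congr rfl fun i _ => mul_comm _ _
    rw [e]; linarith)
  rw [Matrix.mul_sub, trace_sub, mul_vecMulVec, trace_vecMulVec] at h
  simp only [Algebra.mul_smul_comm, mul_one, trace_smul, smul_eq_mul] at h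
  rw [dotProduct_comm]
  linarith

lemma norm_toLin_sq {a b : ℕ} (M : Matrix (Fin a) (Fin b) ℝ) (x : EuclideanSpace ℝ (Fin b)) :
    ‖Matrix.toEuclideanLin M x‖ ^ 2 = (M *ᵥ x.ofLp) ⬝ᵥ (M *ᵥ x.ofLp) := by
  rw [EuclideanSpace.norm_sq_eq]
  simp [dotProduct, pow_two, Matrix.toLpLin_apply]

lemma norm_sq_eq_dot {b : ℕ} (x : EuclideanSpace ℝ (Fin b)) :
    ‖x‖ ^ 2 = x.ofLp ⬝ᵥ x.ofLp := by
  rw [EuclideanSpace.norm_sq_eq]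
  simp [dotProduct, pow_two]

lemma specNorm_bddAbove {a b : ℕ} (M : Matrix (Fin a) (Fin b) ℝ) :
    BddAbove (Set.range fun x : {x : EuclideanSpace ℝ (Fin b) // ‖x‖ ≤ 1} =>
      ‖Matrix.toEuclideanLin M x.1‖) := by
  refine ⟨‖LinearMap.toContinuousLinearMap (Matrix.toEuclideanLin M)‖, ?_⟩
  rintro _ ⟨x, rfl⟩
  have := (LinearMap.toContinuousLinearMap (Matrix.toEuclideanLin M)).le_opNorm x.1
  refine this.trans (mul_le_of_le_one_right (norm_nonneg _) x.2)

lemma specNorm_nonneg {a b : ℕ} (M : Matrix (Fin a) (Fin b) ℝ) : 0 ≤ specNorm M :=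
  Real.iSup_nonneg fun _ => norm_nonneg _

lemma specNorm_norm_bound {a b : ℕ} (M : Matrix (Fin a) (Fin b) ℝ) (x : EuclideanSpace ℝ (Fin b)) :
    ‖Matrix.toEuclideanLin M x‖ ≤ specNorm M * ‖x‖ := by
  by_cases hx : x = 0
  · simp [hx]
  have hx' : 0 < ‖x‖ := norm_pos_iff.2 hx
  have h := le_ciSup (specNorm_bddAbove M) ⟨(‖x‖⁻¹) • x, by
    rw [norm_smul, norm_inv, norm_norm, inv_mul_cancel₀ hx'.ne']⟩
  simp only [map_smul, norm_smul, norm_inv, norm_norm] at h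
  rw [inv_mul_le_iff₀ hx'] at h
  rw [mul_comm]; exact h

lemma specNorm_bound {a b : ℕ} (M : Matrix (Fin a) (Fin b) ℝ) (x : Fin b → ℝ) :
    (M *ᵥ x) ⬝ᵥ (M *ᵥ x) ≤ specNorm M ^ 2 * (x ⬝ᵥ x) := by
  have h := specNorm_norm_bound M (WithLp.toLp 2 x)
  have h2 := pow_le_pow_left₀ (norm_nonneg _) h 2
  rw [mul_pow, norm_toLin_sq, norm_sq_eq_dot] at h2
  exact h2

lemma specNorm_le_maxNorm {a b N : ℕ} (V : Fin N → Matrix (Fin a) (Fin b) ℝ) (i : Fin N) :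
    specNorm (V i) ≤ maxNorm V :=
  le_ciSup (f := fun i => specNorm (V i)) (Set.finite_range _).bddAbove i

lemma maxNorm_nonneg {a b N : ℕ} (V : Fin N → Matrix (Fin a) (Fin b) ℝ) : 0 ≤ maxNorm V :=
  Real.iSup_nonneg fun _ => specNorm_nonneg _

lemma dot_self_nonneg {a : ℕ} (x : Fin a → ℝ) : 0 ≤ x ⬝ᵥ x :=
  Finset.sum_nonneg fun i _ => mul_self_nonneg _

lemma maxNorm_bound {a b N : ℕ} (V : Fin N → Matrix (Fin a) (Fin b) ℝ) (i : Fin N)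
    (x : Fin b → ℝ) : (V i *ᵥ x) ⬝ᵥ (V i *ᵥ x) ≤ maxNorm V ^ 2 * (x ⬝ᵥ x) :=
  (specNorm_bound _ x).trans (mul_le_mul_of_nonneg_right
    (pow_le_pow_left₀ (specNorm_nonneg _) (specNorm_le_maxNorm V i) 2) (dot_self_nonneg x))

lemma maxNorm_quad {a N : ℕ} (V : Fin N → Matrix (Fin a) (Fin a) ℝ) (i : Fin N)
    (x : Fin a → ℝ) : x ⬝ᵥ V i *ᵥ x ≤ maxNorm V * (x ⬝ᵥ x) := by
  have h1 := specNorm_norm_bound (V i) (WithLp.toLp 2 x)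
  have h2 : x ⬝ᵥ V i *ᵥ x = inner ℝ (WithLp.toLp 2 x) (Matrix.toEuclideanLin (V i) (WithLp.toLp 2 x)) := by
    rw [EuclideanSpace.inner_eq_star_dotProduct]
    simp [Matrix.toLpLin_apply, dotProduct_comm]
  have h3 := real_inner_le_norm (WithLp.toLp 2 x) (Matrix.toEuclideanLin (V i) (WithLp.toLp 2 x))
  have h4 := norm_sq_eq_dot (WithLp.toLp 2 x)
  have h5 := specNorm_le_maxNorm V i
  have h6 := norm_nonneg (WithLp.toLp 2 x)
  simp only at h4
  rw [h2, ← h4]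
  calc _ ≤ ‖WithLp.toLp 2 x‖ * (specNorm (V i) * ‖WithLp.toLp 2 x‖) :=
        h3.trans (mul_le_mul_of_nonneg_left h1 h6)
    _ = specNorm (V i) * ‖WithLp.toLp 2 x‖ ^ 2 := by ring
    _ ≤ _ := mul_le_mul_of_nonneg_right h5 (sq_nonneg _)

lemma sigmaMin_le {a : ℕ} (M : Matrix (Fin a) (Fin a) ℝ) (x : EuclideanSpace ℝ (Fin a))
    (hx : ‖x‖ = 1) : sigmaMin M ≤ ‖Matrix.toEuclideanLin M x‖ :=
  ciInf_le (f := fun x : {x : EuclideanSpace ℝ (Fin a) // ‖x‖ = 1} => ‖Matrix.toEuclideanLin M x.1‖)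
    ⟨0, by rintro _ ⟨x, rfl⟩; exact norm_nonneg _⟩ ⟨x, hx⟩

lemma sigmaMin_quad {a : ℕ} {M : Matrix (Fin a) (Fin a) ℝ} (hM : M.PosDef) (x : Fin a → ℝ) :
    sigmaMin M * (x ⬝ᵥ x) ≤ x ⬝ᵥ M *ᵥ x := by
  have hH : (M - sigmaMin M • (1 : Matrix (Fin a) (Fin a) ℝ)).IsHermitian := by
    have h1 := hM.1
    rw [Matrix.IsHermitian, conjTranspose_eq_transpose_of_trivial] at h1 ⊢
    simp [h1]
  have hP : (M - sigmaMin M • (1 : Matrix (Fin a) (Fin a) ℝ)).PosSemidef := by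
    rw [hH.posSemidef_iff_eigenvalues_nonneg]
    intro j
    have he := hH.mulVec_eigenvectorBasis j
    have hn : ‖hH.eigenvectorBasis j‖ = 1 := hH.eigenvectorBasis.orthonormal.1 j
    set u := hH.eigenvectorBasis j with hu
    set l := hH.eigenvalues j with hl
    have hMu : M *ᵥ u.ofLp = (l + sigmaMin M) • u.ofLp := by
      rw [sub_mulVec, smul_mulVec, one_mulVec, sub_eq_iff_eq_add] at he
      rw [add_smul]; exact he
    have hL : Matrix.toEuclideanLin M u = (l + sigmaMin M) • u := by
      ext i
      simpa [Matrix.toLpLin_apply] using congrFun hMu i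
    have h1 := sigmaMin_le M u hn
    rw [hL, norm_smul, hn, mul_one, Real.norm_eq_abs] at h1
    have h2 : 0 ≤ l + sigmaMin M := by
      have h3 := (psd_of_posSemidef hM.posSemidef).2 u.ofLp
      rw [hMu, dotProduct_smul, ← norm_sq_eq_dot, hn] at h3
      simpa using h3
    rw [abs_of_nonneg h2] at h1
    show (0:ℝ) ≤ l
    linarith
  have := (psd_of_posSemidef hP).2 x
  rw [sub_mulVec, smul_mulVec, one_mulVec, dotProduct_sub, dotProduct_smul, smul_eq_mul] at this
  linarith

lemma sigmaMin_pos {a : ℕ} (ha : 0 < a) {M : Matrix (Fin a) (Fin a) ℝ} (hM : M.PosDef) :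
    0 < sigmaMin M := by
  have hne : (Metric.sphere (0 : EuclideanSpace ℝ (Fin a)) 1).Nonempty :=
    ⟨EuclideanSpace.single ⟨0, ha⟩ 1, by simp⟩
  obtain ⟨x0, hx0, hmin⟩ := (isCompact_sphere (0 : EuclideanSpace ℝ (Fin a)) 1).exists_isMinOn hne
    (f := fun x => ‖Matrix.toEuclideanLin M x‖)
    ((LinearMap.continuous_of_finiteDimensional (Matrix.toEuclideanLin M)).norm.continuousOn)
  have hx1 : ‖x0‖ = 1 := by simpa using hx0
  have hpos : 0 < ‖Matrix.toEuclideanLin M x0‖ := by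
    rw [norm_pos_iff]
    intro h
    have hx : x0.ofLp ≠ 0 := by
      intro h0
      have : x0 = 0 := by ext i; simpa using congrFun h0 i
      rw [this] at hx1; simp at hx1
    have h2 := hM.dotProduct_mulVec_pos hx
    have h3 : M *ᵥ x0.ofLp = 0 := by
      have := congrArg WithLp.ofLp h
      simpa [Matrix.toLpLin_apply] using this
    rw [h3] at h2; simp at h2
  have hne' : Nonempty {x : EuclideanSpace ℝ (Fin a) // ‖x‖ = 1} := ⟨⟨x0, hx1⟩⟩
  refine hpos.trans_le (le_ciInf fun x => ?_)
  exact hmin (by simpa using x.2)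

lemma lamMin_quad {a N : ℕ} {V : Fin N → Matrix (Fin a) (Fin a) ℝ} (hV : ∀ i, (V i).PosDef)
    (i : Fin N) (x : Fin a → ℝ) : lamMin V * (x ⬝ᵥ x) ≤ x ⬝ᵥ V i *ᵥ x :=
  (mul_le_mul_of_nonneg_right (ciInf_le (f := fun i => sigmaMin (V i))
    (Set.finite_range _).bddBelow i) (dot_self_nonneg x)).trans (sigmaMin_quad (hV i) x)

lemma lamMin_pos {a N : ℕ} (ha : 0 < a) (hN : 0 < N) {V : Fin N → Matrix (Fin a) (Fin a) ℝ}
    (hV : ∀ i, (V i).PosDef) : 0 < lamMin V := by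
  haveI : Nonempty (Fin N) := ⟨⟨0, hN⟩⟩
  obtain ⟨i, hi⟩ := exists_eq_ciInf_of_finite (f := fun i => sigmaMin (V i))
  rw [lamMin, ← hi]
  exact sigmaMin_pos ha (hV i)

lemma mu_pos {d N : ℕ} (hd : 0 < d) (hN : 0 < N) {piv : Fin N → ℝ} (hpiv : ∀ i, 0 < piv i)
    {Sg : Matrix (Fin d) (Fin d) ℝ} (hSg : Sg.PosDef) : 0 < mu piv Sg := by
  haveI : Nonempty (Fin N) := ⟨⟨0, hN⟩⟩
  obtain ⟨i, hi⟩ := exists_eq_ciInf_of_finite (f := piv)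
  rw [mu, ← hi]
  exact mul_pos (hpiv i) (sigmaMin_pos hd hSg)

lemma mu_quad {d N : ℕ} (hd : 0 < d) {piv : Fin N → ℝ} (hpiv : ∀ i, 0 < piv i)
    {Sg : Matrix (Fin d) (Fin d) ℝ} (hSg : Sg.PosDef) (i : Fin N) (x : Fin d → ℝ) :
    mu piv Sg * (x ⬝ᵥ x) ≤ x ⬝ᵥ (piv i • Sg) *ᵥ x := by
  rw [smul_mulVec, dotProduct_smul, smul_eq_mul, mu, mul_assoc]
  have h1 : (⨅ i, piv i) ≤ piv i := ciInf_le (Set.finite_range _).bddBelow i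
  have h2 := sigmaMin_quad hSg x
  have h3 : 0 ≤ sigmaMin Sg * (x ⬝ᵥ x) := mul_nonneg (sigmaMin_pos hd hSg).le (dot_self_nonneg x)
  exact (mul_le_mul_of_nonneg_right h1 h3).trans (mul_le_mul_of_nonneg_left h2 (hpiv i).le)

/-- `opL` as a linear map. -/
def Lop {d N : ℕ} (Pr : Matrix (Fin N) (Fin N) ℝ) (Γ : Fin N → Matrix (Fin d) (Fin d) ℝ) :
    (Fin N → Matrix (Fin d) (Fin d) ℝ) →ₗ[ℝ] (Fin N → Matrix (Fin d) (Fin d) ℝ) where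
  toFun := opL Pr Γ
  map_add' V W := by
    funext i
    simp [opL, opE, Finset.sum_add_distrib, Matrix.mul_add, Matrix.add_mul]
  map_smul' c V := by
    funext i
    have h : opE Pr (c • V) i = c • opE Pr V i := by
      simp only [opE, Pi.smul_apply, Finset.smul_sum]
      exact Finset.sum_congr rfl fun j _ => smul_comm _ _ _
    simp only [opL, Pi.smul_apply, RingHom.id_apply, h, Matrix.smul_mul, Matrix.mul_smul]

/-- `opT` as a linear map. -/
def Top {d N : ℕ} (Pr : Matrix (Fin N) (Fin N) ℝ) (Γ : Fin N → Matrix (Fin d) (Fin d) ℝ) :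
    (Fin N → Matrix (Fin d) (Fin d) ℝ) →ₗ[ℝ] (Fin N → Matrix (Fin d) (Fin d) ℝ) where
  toFun := opT Pr Γ
  map_add' V W := by
    funext i
    simp [opT, Finset.sum_add_distrib, Matrix.mul_add, Matrix.add_mul]
  map_smul' c V := by
    funext i
    simp only [opT, Pi.smul_apply, RingHom.id_apply, Matrix.smul_mul, Matrix.mul_smul,
      Finset.smul_sum]
    simp only [smul_comm c]

lemma Lop_apply {d N : ℕ} (Pr : Matrix (Fin N) (Fin N) ℝ) (Γ V : Fin N → Matrix (Fin d) (Fin d) ℝ) :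
    Lop Pr Γ V = opL Pr Γ V := rfl

lemma Top_apply {d N : ℕ} (Pr : Matrix (Fin N) (Fin N) ℝ) (Γ V : Fin N → Matrix (Fin d) (Fin d) ℝ) :
    Top Pr Γ V = opT Pr Γ V := rfl

lemma pair_dual {d N : ℕ} (Pr : Matrix (Fin N) (Fin N) ℝ) (Γ V W : Fin N → Matrix (Fin d) (Fin d) ℝ) :
    pair (Top Pr Γ V) W = pair V (Lop Pr Γ W) := by
  simp only [pair, Top_apply, Lop_apply, opT, opL, opE]
  simp only [Finset.sum_mul, Finset.mul_sum, trace_sum, Matrix.smul_mul, Matrix.mul_smul, trace_smul]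
  rw [Finset.sum_comm]
  refine Finset.sum_congr rfl fun i _ => Finset.sum_congr rfl fun j _ => ?_
  congr 1
  rw [trace_mul_comm (V i), Matrix.mul_assoc (Γ i), Matrix.mul_assoc (Γ i), trace_mul_comm (Γ i),
    Matrix.mul_assoc, Matrix.mul_assoc, Matrix.mul_assoc, Matrix.mul_assoc, trace_mul_comm (V i)]
  simp only [Matrix.mul_assoc]

lemma pair_dual_pow {d N : ℕ} (Pr : Matrix (Fin N) (Fin N) ℝ)
    (Γ V W : Fin N → Matrix (Fin d) (Fin d) ℝ) (n : ℕ) :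
    pair ((Top Pr Γ ^ n) V) W = pair V ((Lop Pr Γ ^ n) W) := by
  induction n generalizing V with
  | zero => simp
  | succ n ih =>
    rw [pow_succ, Module.End.mul_apply, ih, pair_dual, pow_succ', Module.End.mul_apply]

/-- Powers tend to zero pointwise. -/
def Stab {d N : ℕ} (F : (Fin N → Matrix (Fin d) (Fin d) ℝ) →ₗ[ℝ] (Fin N → Matrix (Fin d) (Fin d) ℝ)) :
    Prop := ∀ V, Tendsto (fun n : ℕ => (F ^ n) V) atTop (𝓝 0)

section generic
variable {d N : ℕ} {F : (Fin N → Matrix (Fin d) (Fin d) ℝ) →ₗ[ℝ] (Fin N → Matrix (Fin d) (Fin d) ℝ)}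

lemma Stab.fix_eq_zero (h : Stab F) {W : Fin N → Matrix (Fin d) (Fin d) ℝ} (hW : F W = W) :
    W = 0 := by
  have h1 : ∀ n : ℕ, (F ^ n) W = W := by
    intro n
    induction n with
    | zero => simp
    | succ n ih => rw [pow_succ, Module.End.mul_apply, hW, ih]
  have h2 := h W
  simp only [h1] at h2
  exact tendsto_nhds_unique tendsto_const_nhds h2

lemma Stab.injective (h : Stab F) : Function.Injective ((1 : Module.End ℝ (Fin N → Matrix (Fin d) (Fin d) ℝ)) - F) := by
  rw [← LinearMap.ker_eq_bot, LinearMap.ker_eq_bot']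
  intro W hW
  refine h.fix_eq_zero ?_
  rw [LinearMap.sub_apply, Module.End.one_apply, sub_eq_zero] at hW
  exact hW.symm

lemma Stab.exists_sol (h : Stab F) (S : Fin N → Matrix (Fin d) (Fin d) ℝ) : ∃ W, W = S + F W := by
  obtain ⟨W, hW⟩ := (LinearMap.injective_iff_surjective.1 h.injective) S
  refine ⟨W, ?_⟩
  rw [← hW]; simp

lemma Stab.unique (h : Stab F) {S W W' : Fin N → Matrix (Fin d) (Fin d) ℝ} (hW : W = S + F W)
    (hW' : W' = S + F W') : W = W' := by
  apply h.injective
  rw [LinearMap.sub_apply, LinearMap.sub_apply, Module.End.one_apply, Module.End.one_apply]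
  rw [sub_eq_iff_eq_add.2 hW, sub_eq_iff_eq_add.2 hW']

lemma sol_iter {S W : Fin N → Matrix (Fin d) (Fin d) ℝ} (hW : W = S + F W) (n : ℕ) :
    ∑ s ∈ Finset.range n, (F ^ s) S = W - (F ^ n) W := by
  induction n with
  | zero => simp
  | succ n ih =>
    have : (F ^ n) W = (F ^ n) S + (F ^ (n+1)) W := by
      conv_lhs => rw [hW]
      rw [map_add, pow_succ, Module.End.mul_apply]
    rw [Finset.sum_range_succ, ih, this]; abel

lemma Stab.psd (h : Stab F) (hpos : ∀ V, (∀ i, PSD (V i)) → ∀ i, PSD (F V i))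
    {S W : Fin N → Matrix (Fin d) (Fin d) ℝ} (hW : W = S + F W) (hS : ∀ i, PSD (S i)) :
    ∀ i, PSD (W i) := by
  have hpow : ∀ n : ℕ, ∀ i, PSD ((F ^ n) S i) := by
    intro n
    induction n with
    | zero => simpa using hS
    | succ n ih => intro i; rw [pow_succ', Module.End.mul_apply]; exact hpos _ ih i
  have hlim : Tendsto (fun n : ℕ => W - (F ^ n) W) atTop (𝓝 W) := by
    simpa using (h W).const_sub W
  intro i
  have hi : Tendsto (fun n : ℕ => (W - (F ^ n) W) i) atTop (𝓝 (W i)) :=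
    ((continuous_apply i).tendsto W).comp hlim
  refine isClosed_psd.mem_of_tendsto hi (Eventually.of_forall fun n => ?_)
  rw [← sol_iter hW n, Finset.sum_apply]
  exact psd_sum _ _ fun s _ => hpow s i
end generic

lemma psd_opE {d N : ℕ} {Pr : Matrix (Fin N) (Fin N) ℝ} (hPr : ∀ i j, 0 ≤ Pr i j)
    {V : Fin N → Matrix (Fin d) (Fin d) ℝ} (hV : ∀ i, PSD (V i)) (i) : PSD (opE Pr V i) :=
  psd_sum _ _ fun j _ => (hV j).smul (hPr i j)

lemma psd_Lop {d N : ℕ} {Pr : Matrix (Fin N) (Fin N) ℝ} (hPr : ∀ i j, 0 ≤ Pr i j)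
    (Γ : Fin N → Matrix (Fin d) (Fin d) ℝ)
    (V : Fin N → Matrix (Fin d) (Fin d) ℝ) (hV : ∀ i, PSD (V i)) (i) : PSD (Lop Pr Γ V i) :=
  (psd_opE hPr hV i).conj _

lemma psd_Top {d N : ℕ} {Pr : Matrix (Fin N) (Fin N) ℝ} (hPr : ∀ i j, 0 ≤ Pr i j)
    (Γ : Fin N → Matrix (Fin d) (Fin d) ℝ)
    (V : Fin N → Matrix (Fin d) (Fin d) ℝ) (hV : ∀ i, PSD (V i)) (i) : PSD (Top Pr Γ V i) := by
  rw [Top_apply, opT]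
  refine psd_sum _ _ fun j _ => PSD.smul ?_ (hPr j i)
  have := (hV j).conj (Γ j)ᵀ
  rwa [transpose_transpose] at this

/-- Elementary tuple. -/
noncomputable def elem {d N : ℕ} (i : Fin N) (a b : Fin d) : Fin N → Matrix (Fin d) (Fin d) ℝ :=
  Pi.single i (Matrix.single b a 1)

lemma pair_elem {d N : ℕ} (V : Fin N → Matrix (Fin d) (Fin d) ℝ) (i : Fin N) (a b : Fin d) :
    pair V (elem i a b) = V i a b := by
  rw [pair, Finset.sum_eq_single i]
  · simp [elem, trace_mul_single]
  · intro j _ hj; simp [elem, hj]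
  · simp

lemma pair_tendsto_right {d N : ℕ} (V : Fin N → Matrix (Fin d) (Fin d) ℝ) :
    Continuous (fun W => pair V W) := by
  unfold pair; fun_prop

lemma Stab.dual {d N : ℕ} {Pr : Matrix (Fin N) (Fin N) ℝ} {Γ : Fin N → Matrix (Fin d) (Fin d) ℝ}
    (h : Stab (Lop Pr Γ)) : Stab (Top Pr Γ) := by
  intro V
  refine tendsto_pi_nhds.2 fun i => tendsto_pi_nhds.2 fun a => tendsto_pi_nhds.2 fun b => ?_
  have h1 : ∀ n : ℕ, (Top Pr Γ ^ n) V i a b = pair V ((Lop Pr Γ ^ n) (elem i a b)) := by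
    intro n; rw [← pair_dual_pow, pair_elem]
  simp only [h1]
  have h0 : pair V 0 = 0 := by simp [pair]
  have := ((pair_tendsto_right V).tendsto 0).comp (h (elem i a b))
  rw [h0] at this
  exact this

/-- pairing identity -/
lemma pair_sol {d N : ℕ} {Pr : Matrix (Fin N) (Fin N) ℝ} {Γ X X0 S W : Fin N → Matrix (Fin d) (Fin d) ℝ}
    (hX : X = X0 + Top Pr Γ X) (hW : W = S + Lop Pr Γ W) : pair X0 W = pair X S := by
  have h1 : pair X W = pair X0 W + pair X (Lop Pr Γ W) := by
    conv_lhs => rw [hX]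
    rw [pair_add_left, pair_dual]
  have h2 : pair X W = pair X S + pair X (Lop Pr Γ W) := by
    conv_lhs => rw [hW]
    rw [pair_add_right]
  linarith

/-- A Lyapunov certificate implies stability. -/
lemma stab_of_cert {d N : ℕ} {Pr : Matrix (Fin N) (Fin N) ℝ} (hPr : ∀ i j, 0 ≤ Pr i j)
    {Γ P : Fin N → Matrix (Fin d) (Fin d) ℝ} {l c : ℝ} (hl : 0 < l) (hc0 : 0 ≤ c) (hc : c < 1)
    (hP : ∀ i x, l * (x ⬝ᵥ x) ≤ x ⬝ᵥ P i *ᵥ x)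
    (hLP : ∀ i x, x ⬝ᵥ (Lop Pr Γ P i) *ᵥ x ≤ c * (x ⬝ᵥ P i *ᵥ x)) : Stab (Lop Pr Γ) := by
  intro V
  have hbil : ∀ (W : Fin N → Matrix (Fin d) (Fin d) ℝ) i x y, x ⬝ᵥ (Lop Pr Γ W i) *ᵥ y =
      ∑ j, Pr i j * ((Γ i *ᵥ x) ⬝ᵥ W j *ᵥ (Γ i *ᵥ y)) := by
    intro W i x y
    rw [Lop_apply, opL, quad_conj, opE, sum_mulVec, dotProduct_sum]
    simp only [smul_mulVec, dotProduct_smul, smul_eq_mul]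
  have hstep : ∀ (m : ℝ) (W : Fin N → Matrix (Fin d) (Fin d) ℝ), 0 ≤ m →
      (∀ i x y, |x ⬝ᵥ W i *ᵥ y| ≤ m * (x ⬝ᵥ P i *ᵥ x + y ⬝ᵥ P i *ᵥ y)) →
      (∀ i x y, |x ⬝ᵥ (Lop Pr Γ W i) *ᵥ y| ≤ (c * m) * (x ⬝ᵥ P i *ᵥ x + y ⬝ᵥ P i *ᵥ y)) := by
    intro m W hm hW i x y
    calc |x ⬝ᵥ (Lop Pr Γ W i) *ᵥ y| = |∑ j, Pr i j * ((Γ i *ᵥ x) ⬝ᵥ W j *ᵥ (Γ i *ᵥ y))| := by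
          rw [hbil]
      _ ≤ ∑ j, Pr i j * (m * ((Γ i *ᵥ x) ⬝ᵥ P j *ᵥ (Γ i *ᵥ x) + (Γ i *ᵥ y) ⬝ᵥ P j *ᵥ (Γ i *ᵥ y))) := by
          refine (Finset.abs_sum_le_sum_abs _ _).trans (Finset.sum_le_sum fun j _ => ?_)
          rw [abs_mul, abs_of_nonneg (hPr i j)]
          exact mul_le_mul_of_nonneg_left (hW j _ _) (hPr i j)
      _ = m * (x ⬝ᵥ (Lop Pr Γ P i) *ᵥ x + y ⬝ᵥ (Lop Pr Γ P i) *ᵥ y) := by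
          rw [hbil, hbil, ← Finset.sum_add_distrib, Finset.mul_sum]
          exact Finset.sum_congr rfl fun j _ => by ring
      _ ≤ m * (c * (x ⬝ᵥ P i *ᵥ x) + c * (y ⬝ᵥ P i *ᵥ y)) :=
          mul_le_mul_of_nonneg_left (add_le_add (hLP i x) (hLP i y)) hm
      _ = _ := by ring
  obtain ⟨m, hm0, hm⟩ : ∃ m, 0 ≤ m ∧ ∀ i x y, |x ⬝ᵥ V i *ᵥ y| ≤ m * (x ⬝ᵥ P i *ᵥ x + y ⬝ᵥ P i *ᵥ y) := by
    refine ⟨(∑ i, ∑ a, ∑ b, |V i a b|) / l, by positivity, fun i x y => ?_⟩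
    have h1 : (∑ a, ∑ b, |V i a b|) ≤ ∑ i, ∑ a, ∑ b, |V i a b| :=
      Finset.single_le_sum (f := fun i => ∑ a, ∑ b, |V i a b|) (fun j _ => by positivity)
        (Finset.mem_univ i)
    have h2 := bil_bound (V i) x y
    have h3 := hP i x
    have h4 := hP i y
    have h5 := dot_self_nonneg x
    have h6 := dot_self_nonneg y
    have h0 : (0:ℝ) ≤ ∑ i, ∑ a, ∑ b, |V i a b| := by positivity
    calc _ ≤ (∑ i, ∑ a, ∑ b, |V i a b|) * ((x ⬝ᵥ x + y ⬝ᵥ y) / 2) :=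
          h2.trans (mul_le_mul_of_nonneg_right h1 (by positivity))
      _ ≤ (∑ i, ∑ a, ∑ b, |V i a b|) * ((x ⬝ᵥ P i *ᵥ x + y ⬝ᵥ P i *ᵥ y) / l) := by
          refine mul_le_mul_of_nonneg_left ?_ h0
          rw [le_div_iff₀ hl]; nlinarith [mul_nonneg hl.le h5, mul_nonneg hl.le h6]
      _ = _ := by ring
  have hpow : ∀ n : ℕ, ∀ i x y, |x ⬝ᵥ ((Lop Pr Γ ^ n) V i) *ᵥ y| ≤
      (c ^ n * m) * (x ⬝ᵥ P i *ᵥ x + y ⬝ᵥ P i *ᵥ y) := by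
    intro n
    induction n with
    | zero => simpa using hm
    | succ n ih =>
      intro i x y
      have := hstep _ _ (by positivity) ih i x y
      rw [pow_succ', Module.End.mul_apply, pow_succ', mul_assoc c]
      exact this
  refine tendsto_pi_nhds.2 fun i => tendsto_pi_nhds.2 fun a => tendsto_pi_nhds.2 fun b => ?_
  have hlim : Tendsto (fun n : ℕ => (c ^ n * m) * (Pi.single a 1 ⬝ᵥ P i *ᵥ Pi.single a 1 +
      Pi.single b 1 ⬝ᵥ P i *ᵥ Pi.single b 1)) atTop (𝓝 0) := by
    have := ((tendsto_pow_atTop_nhds_zero_of_lt_one hc0 hc).mul_const m).mul_const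
      (Pi.single a 1 ⬝ᵥ P i *ᵥ Pi.single a 1 + Pi.single b 1 ⬝ᵥ P i *ᵥ Pi.single b 1)
    simpa using this
  refine squeeze_zero_norm (fun n => ?_) hlim
  have := hpow n i (Pi.single a 1) (Pi.single b 1)
  rw [Real.norm_eq_abs]
  convert this using 2
  simp

section gelfand
open scoped ENNReal NNReal

lemma summable_norm_pow_of_spectralRadius {A : Type*} [NormedRing A] [NormedAlgebra ℂ A]
    [CompleteSpace A] (a : A) (h : spectralRadius ℂ a < 1) : Summable fun n : ℕ => ‖a ^ n‖ := by
  obtain ⟨r, hr1, hr2⟩ := ENNReal.lt_iff_exists_nnreal_btwn.1 h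
  have hr2' : r < 1 := by exact_mod_cast hr2
  have hev := (spectrum.pow_nnnorm_pow_one_div_tendsto_nhds_spectralRadius a).eventually_lt_const hr1
  have hgeo : Summable fun n : ℕ => (r : ℝ) ^ n :=
    summable_geometric_of_lt_one r.2 (by exact_mod_cast hr2')
  refine Summable.of_norm_bounded_eventually_nat hgeo ?_
  filter_upwards [hev, eventually_gt_atTop 0] with n hn hn0
  have hn' : (0:ℝ) < n := by exact_mod_cast hn0
  have h1 := ENNReal.rpow_le_rpow hn.le hn'.le
  rw [← ENNReal.rpow_mul, one_div, inv_mul_cancel₀ hn'.ne', ENNReal.rpow_one,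
    ENNReal.rpow_natCast] at h1
  have h2 : ‖a ^ n‖₊ ≤ r ^ n := by exact_mod_cast h1
  rw [norm_norm]
  exact_mod_cast h2
end gelfand

section
attribute [local instance] Matrix.linftyOpNormedRing Matrix.linftyOpNormedAlgebra
lemma summable_entry_of_spectralRadius {n : Type*} [Fintype n] [DecidableEq n] (M : Matrix n n ℝ)
    (h : spectralRadius ℂ (M.map (algebraMap ℝ ℂ)) < 1) (i j : n) :
    Summable fun m : ℕ => (M ^ m) i j := by
  have hcomp : @CompleteSpace (Matrix n n ℂ) (Matrix.linftyOpNormedRing (n := n) (α := ℂ)).toUniformSpace :=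
    inferInstanceAs (CompleteSpace (n → n → ℂ))
  have h1 := @summable_norm_pow_of_spectralRadius _ Matrix.linftyOpNormedRing
    Matrix.linftyOpNormedAlgebra hcomp (M.map (algebraMap ℝ ℂ)) h
  refine Summable.of_norm_bounded h1 fun m => ?_
  have h2 : (M.map (algebraMap ℝ ℂ)) ^ m = (M ^ m).map (algebraMap ℝ ℂ) := by
    exact (map_pow (algebraMap ℝ ℂ).mapMatrix M m).symm
  rw [h2, Matrix.linfty_opNorm_def]
  have h3 : ‖(M ^ m) i j‖₊ = ‖((M ^ m).map (algebraMap ℝ ℂ)) i j‖₊ := by simp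
  rw [← coe_nnnorm, NNReal.coe_le_coe, h3]
  refine le_trans ?_ (Finset.le_sup (f := fun i => ∑ j, ‖((M ^ m).map (algebraMap ℝ ℂ)) i j‖₊) (Finset.mem_univ i))
  exact Finset.single_le_sum (f := fun j => ‖((M ^ m).map (algebraMap ℝ ℂ)) i j‖₊) (fun _ _ => zero_le) (Finset.mem_univ j)
end

/-- vectorization -/
def vecT {d N : ℕ} (V : Fin N → Matrix (Fin d) (Fin d) ℝ) : Fin N × Fin d × Fin d → ℝ :=
  fun p => V p.1 p.2.1 p.2.2

lemma calA_mulVec {d N : ℕ} (Pr : Matrix (Fin N) (Fin N) ℝ) (Γ V : Fin N → Matrix (Fin d) (Fin d) ℝ) :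
    calA Pr Γ *ᵥ vecT V = vecT (Lop Pr Γ V) := by
  have h1 : (Pr ⊗ₖ (1 : Matrix (Fin d × Fin d) (Fin d × Fin d) ℝ)) *ᵥ vecT V = vecT (opE Pr V) := by
    funext ⟨i, a⟩
    simp only [mulVec, dotProduct, Fintype.sum_prod_type (α₁ := Fin N), kronecker_apply, one_apply, vecT, opE]
    rw [Matrix.sum_apply]
    refine Finset.sum_congr rfl fun j _ => ?_
    rw [Finset.sum_eq_single a]
    · simp
    · intro b _ hb; simp [Ne.symm hb]
    · simp
  rw [calA, ← mulVec_mulVec, h1]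
  funext ⟨i, a, b⟩
  simp only [mulVec, dotProduct, Fintype.sum_prod_type (α₁ := Fin N), reindex_apply, submatrix_apply,
    vecT, Lop_apply, opL]
  rw [Finset.sum_eq_single i]
  · simp only [Equiv.prodComm_symm, Equiv.prodComm_apply, Prod.swap_prod_mk, blockDiagonal_apply_eq,
      Fintype.sum_prod_type, kronecker_apply, transpose_apply, mul_apply, Finset.sum_mul]
    rw [Finset.sum_comm]
    refine Finset.sum_congr rfl fun x _ => Finset.sum_congr rfl fun y _ => by ring
  · intro j _ hj
    refine Finset.sum_eq_zero fun x _ => ?_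
    simp [blockDiagonal_apply, Ne.symm hj]
  · simp

lemma calA_pow_mulVec {d N : ℕ} (Pr : Matrix (Fin N) (Fin N) ℝ) (Γ V : Fin N → Matrix (Fin d) (Fin d) ℝ)
    (n : ℕ) : (calA Pr Γ ^ n) *ᵥ vecT V = vecT ((Lop Pr Γ ^ n) V) := by
  induction n with
  | zero => simp
  | succ n ih => rw [pow_succ', ← mulVec_mulVec, ih, calA_mulVec, pow_succ', Module.End.mul_apply]

lemma MSS.summable_entry {d k N : ℕ} {Pr : Matrix (Fin N) (Fin N) ℝ}
    {A : Fin N → Matrix (Fin d) (Fin d) ℝ} {B : Fin N → Matrix (Fin d) (Fin k) ℝ}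
    {K : Fin N → Matrix (Fin k) (Fin d) ℝ} (h : MSS Pr A B K) (V : Fin N → Matrix (Fin d) (Fin d) ℝ)
    (i : Fin N) (a b : Fin d) : Summable fun n : ℕ => ((Lop Pr (Gam A B K)) ^ n) V i a b := by
  have h1 : ∀ n : ℕ, ((Lop Pr (Gam A B K)) ^ n) V i a b =
      ∑ p, ((calA Pr (Gam A B K)) ^ n) (i, a, b) p * vecT V p := by
    intro n
    have := congrFun (calA_pow_mulVec Pr (Gam A B K) V n) (i, a, b)
    rw [mulVec, dotProduct] at this
    exact this.symm
  simp only [h1]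
  exact summable_sum fun p _ => (summable_entry_of_spectralRadius _ h _ _).mul_right _

lemma MSS.stab {d k N : ℕ} {Pr : Matrix (Fin N) (Fin N) ℝ}
    {A : Fin N → Matrix (Fin d) (Fin d) ℝ} {B : Fin N → Matrix (Fin d) (Fin k) ℝ}
    {K : Fin N → Matrix (Fin k) (Fin d) ℝ} (h : MSS Pr A B K) : Stab (Lop Pr (Gam A B K)) :=
  fun V => tendsto_pi_nhds.2 fun i => tendsto_pi_nhds.2 fun a => tendsto_pi_nhds.2 fun b =>
    (h.summable_entry V i a b).tendsto_atTop_zero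

lemma MSS.XK_eq {d k N : ℕ} {Pr : Matrix (Fin N) (Fin N) ℝ}
    {A : Fin N → Matrix (Fin d) (Fin d) ℝ} {B : Fin N → Matrix (Fin d) (Fin k) ℝ}
    {K : Fin N → Matrix (Fin k) (Fin d) ℝ} (h : MSS Pr A B K) (piv : Fin N → ℝ)
    (Sg : Matrix (Fin d) (Fin d) ℝ) :
    XK Pr piv Sg (Gam A B K) = (fun i => piv i • Sg) +
      Top Pr (Gam A B K) (XK Pr piv Sg (Gam A B K)) := by
  set X0 : Fin N → Matrix (Fin d) (Fin d) ℝ := fun i => piv i • Sg with hX0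
  obtain ⟨X, hX⟩ := h.stab.dual.exists_sol X0
  have hit : ∀ t : ℕ, (opT Pr (Gam A B K))^[t] X0 = ((Top Pr (Gam A B K)) ^ t) X0 := by
    intro t; rw [Module.End.pow_apply]; rfl
  have hsum : Summable fun t : ℕ => ((Top Pr (Gam A B K)) ^ t) X0 := by
    refine Pi.summable.2 fun i => Pi.summable.2 fun a => Pi.summable.2 fun b => ?_
    have h1 : ∀ n : ℕ, ((Top Pr (Gam A B K)) ^ n) X0 i a b =
        pair X0 ((Lop Pr (Gam A B K) ^ n) (elem i a b)) := by
      intro n; rw [← pair_dual_pow, pair_elem]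
    simp only [h1, pair, trace, diag_apply, mul_apply]
    exact summable_sum fun j _ => summable_sum fun x _ => summable_sum fun y _ =>
      (h.summable_entry _ _ _ _).mul_left _
  have hXK : XK Pr piv Sg (Gam A B K) = X := by
    rw [XK]
    simp only [← hX0, hit]
    have h1 := hsum.hasSum.tendsto_sum_nat
    simp only [sol_iter hX] at h1
    have h2 : Tendsto (fun n : ℕ => X - ((Top Pr (Gam A B K)) ^ n) X) atTop (𝓝 X) := by
      simpa using (h.stab.dual X).const_sub X
    exact tendsto_nhds_unique h1 h2
  rw [hXK]; exact hX

section matcalc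
variable {F : Type*} [NormedAddCommGroup F] [NormedSpace ℝ F]

lemma contDiff_matmul {a b c : ℕ} {n : WithTop ℕ∞} {f : F → Matrix (Fin a) (Fin b) ℝ}
    {g : F → Matrix (Fin b) (Fin c) ℝ} (hf : ContDiff ℝ n f) (hg : ContDiff ℝ n g) :
    ContDiff ℝ n (fun x => f x * g x) := by
  refine contDiff_pi.2 fun i => contDiff_pi.2 fun j => ?_
  have hf' := fun i j => contDiff_pi.1 (contDiff_pi.1 hf i) j
  have hg' := fun i j => contDiff_pi.1 (contDiff_pi.1 hg i) j
  simp only [mul_apply]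
  exact ContDiff.sum fun l _ => (hf' i l).mul (hg' l j)

lemma contDiff_transpose {a b : ℕ} {n : WithTop ℕ∞} {f : F → Matrix (Fin a) (Fin b) ℝ}
    (hf : ContDiff ℝ n f) : ContDiff ℝ n (fun x => (f x)ᵀ) :=
  contDiff_pi.2 fun i => contDiff_pi.2 fun j => contDiff_pi.1 (contDiff_pi.1 hf j) i

lemma hasDerivAt_matmul {a b c : ℕ} {f : ℝ → Matrix (Fin a) (Fin b) ℝ}
    {g : ℝ → Matrix (Fin b) (Fin c) ℝ} {f' : Matrix (Fin a) (Fin b) ℝ}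
    {g' : Matrix (Fin b) (Fin c) ℝ} {t : ℝ} (hf : HasDerivAt f f' t) (hg : HasDerivAt g g' t) :
    HasDerivAt (fun x => f x * g x) (f' * g t + f t * g') t := by
  refine hasDerivAt_pi.2 fun i => hasDerivAt_pi.2 fun j => ?_
  have hf' := fun i j => hasDerivAt_pi.1 (hasDerivAt_pi.1 hf i) j
  have hg' := fun i j => hasDerivAt_pi.1 (hasDerivAt_pi.1 hg i) j
  simp only [mul_apply, Matrix.add_apply]
  rw [← Finset.sum_add_distrib]
  exact HasDerivAt.fun_sum fun l _ => (hf' i l).mul (hg' l j)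

lemma hasDerivAt_transpose {a b : ℕ} {f : ℝ → Matrix (Fin a) (Fin b) ℝ} {f' : Matrix (Fin a) (Fin b) ℝ}
    {t : ℝ} (hf : HasDerivAt f f' t) : HasDerivAt (fun x => (f x)ᵀ) (f'ᵀ) t :=
  hasDerivAt_pi.2 fun i => hasDerivAt_pi.2 fun j => hasDerivAt_pi.1 (hasDerivAt_pi.1 hf j) i

lemma hasDerivAt_opE {d N : ℕ} (Pr : Matrix (Fin N) (Fin N) ℝ)
    {f : ℝ → Fin N → Matrix (Fin d) (Fin d) ℝ} {f' : Fin N → Matrix (Fin d) (Fin d) ℝ}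
    {t : ℝ} (hf : HasDerivAt f f' t) (i : Fin N) :
    HasDerivAt (fun x => opE Pr (f x) i) (opE Pr f' i) t := by
  unfold opE
  exact HasDerivAt.fun_sum fun j _ => (hasDerivAt_pi.1 hf j).const_smul (Pr i j)

end matcalc

section lyap
variable {d k N : ℕ} (Pr : Matrix (Fin N) (Fin N) ℝ)
    (A : Fin N → Matrix (Fin d) (Fin d) ℝ) (B : Fin N → Matrix (Fin d) (Fin k) ℝ)
    (Q : Fin N → Matrix (Fin d) (Fin d) ℝ) (R : Fin N → Matrix (Fin k) (Fin k) ℝ)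

/-- Source term of the Lyapunov equation. -/
def srcS (K : Fin N → Matrix (Fin k) (Fin d) ℝ) : Fin N → Matrix (Fin d) (Fin d) ℝ :=
  fun i => Q i + (K i)ᵀ * R i * K i

lemma isLyap_iff (K : Fin N → Matrix (Fin k) (Fin d) ℝ) (P : Fin N → Matrix (Fin d) (Fin d) ℝ) :
    IsLyap Pr A B Q R K P ↔ P = srcS Q R K + Lop Pr (Gam A B K) P := by
  constructor
  · intro h; funext i; exact h i
  · intro h i; exact congrFun h i

/-- Continuous linear version. -/
noncomputable def Lc (K : Fin N → Matrix (Fin k) (Fin d) ℝ) :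
    (Fin N → Fin d → Fin d → ℝ) →L[ℝ] (Fin N → Fin d → Fin d → ℝ) :=
  LinearMap.toContinuousLinearMap
    (show (Fin N → Fin d → Fin d → ℝ) →ₗ[ℝ] (Fin N → Fin d → Fin d → ℝ) from Lop Pr (Gam A B K))

lemma Lc_apply (K : Fin N → Matrix (Fin k) (Fin d) ℝ) (V : Fin N → Matrix (Fin d) (Fin d) ℝ) :
    Lc Pr A B K V = Lop Pr (Gam A B K) V := rfl

lemma contDiff_proj (i : Fin N) : ContDiff ℝ 2 (fun K : Fin N → Matrix (Fin k) (Fin d) ℝ => K i) :=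
  contDiff_apply ℝ (Matrix (Fin k) (Fin d) ℝ) i

lemma contDiff_Gam (i : Fin N) :
    ContDiff ℝ 2 (fun K : Fin N → Matrix (Fin k) (Fin d) ℝ => Gam A B K i) := by
  unfold Gam
  exact contDiff_const.sub (contDiff_matmul contDiff_const (contDiff_proj i))

lemma contDiff_Lc : ContDiff ℝ 2 (Lc Pr A B) := by
  refine contDiff_clm_apply_iff.2 fun V => contDiff_pi.2 fun i => ?_
  have h := contDiff_matmul (contDiff_matmul (contDiff_transpose (contDiff_Gam A B i))
    (contDiff_const (c := opE Pr (show Fin N → Matrix (Fin d) (Fin d) ℝ from V) i)))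
    (contDiff_Gam A B i)
  exact h

lemma contDiff_srcS : ContDiff ℝ 2 (srcS (d := d) (k := k) (N := N) Q R) := by
  refine contDiff_pi.2 fun i => ?_
  unfold srcS
  exact contDiff_const.add (contDiff_matmul (contDiff_matmul (contDiff_transpose (contDiff_proj i))
    contDiff_const) (contDiff_proj i))

variable {Pr A B}

lemma isUnit_of_stab {K : Fin N → Matrix (Fin k) (Fin d) ℝ} (h : Stab (Lop Pr (Gam A B K))) :
    IsUnit (1 - Lc Pr A B K) := by
  have hinj := h.injective
  have hker : LinearMap.ker ((1 - Lc Pr A B K : (Fin N → Fin d → Fin d → ℝ) →L[ℝ] (Fin N → Fin d → Fin d → ℝ)) :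
      (Fin N → Fin d → Fin d → ℝ) →ₗ[ℝ] (Fin N → Fin d → Fin d → ℝ)) = ⊥ := by
    rw [LinearMap.ker_eq_bot]
    exact hinj
  let e := (LinearEquiv.ofInjectiveEndo _ (LinearMap.ker_eq_bot.1 hker)).toContinuousLinearEquiv
  refine ⟨⟨1 - Lc Pr A B K, (e.symm : _ →L[ℝ] _), ?_, ?_⟩, rfl⟩
  · refine ContinuousLinearMap.ext fun V => ?_; exact e.apply_symm_apply V
  · refine ContinuousLinearMap.ext fun V => ?_; exact e.symm_apply_apply V

variable {Q R}

lemma inverse_sol {V : Type*} [NormedAddCommGroup V] [NormedSpace ℝ V] {T : V →L[ℝ] V}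
    (h : IsUnit T) (p s : V) : T p = s ↔ p = Ring.inverse T s := by
  constructor
  · intro h1
    rw [← h1, ← mul_apply_eq_comp, Ring.inverse_mul_cancel _ h]; rfl
  · intro h1
    rw [h1, ← mul_apply_eq_comp, Ring.mul_inverse_cancel _ h]; rfl

variable (Pr A B Q R) in
/-- Solution of the Lyapunov equation through the inverse. -/
noncomputable def solK (K : Fin N → Matrix (Fin k) (Fin d) ℝ) : Fin N → Matrix (Fin d) (Fin d) ℝ :=
  Ring.inverse (1 - Lc Pr A B K) (srcS Q R K)

lemma isLyap_iff_sol {K : Fin N → Matrix (Fin k) (Fin d) ℝ} (h : IsUnit (1 - Lc Pr A B K))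
    (P : Fin N → Matrix (Fin d) (Fin d) ℝ) : IsLyap Pr A B Q R K P ↔ P = solK Pr A B Q R K := by
  rw [isLyap_iff, ← sub_eq_iff_eq_add]
  exact inverse_sol h P (srcS Q R K)

lemma PK_of_unit {K : Fin N → Matrix (Fin k) (Fin d) ℝ} (h : IsUnit (1 - Lc Pr A B K)) :
    PK Pr A B Q R K = solK Pr A B Q R K := by
  have hex : ∃ P, IsLyap Pr A B Q R K P := ⟨_, (isLyap_iff_sol h _).2 rfl⟩
  rw [PK, dif_pos hex]
  exact (isLyap_iff_sol h _).1 hex.choose_spec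

lemma isLyap_of_unit {K : Fin N → Matrix (Fin k) (Fin d) ℝ} (h : IsUnit (1 - Lc Pr A B K)) :
    IsLyap Pr A B Q R K (PK Pr A B Q R K) :=
  (isLyap_iff_sol h _).2 (PK_of_unit h)

lemma PK_unique {K : Fin N → Matrix (Fin k) (Fin d) ℝ} (h : IsUnit (1 - Lc Pr A B K))
    {P : Fin N → Matrix (Fin d) (Fin d) ℝ} (hP : IsLyap Pr A B Q R K P) : PK Pr A B Q R K = P := by
  rw [PK_of_unit h, ← (isLyap_iff_sol h _).1 hP]

lemma eventually_unit {K : Fin N → Matrix (Fin k) (Fin d) ℝ} (h : IsUnit (1 - Lc Pr A B K)) :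
    ∀ᶠ K' in 𝓝 K, IsUnit (1 - Lc Pr A B K') := by
  have hc : Continuous fun K' => 1 - Lc Pr A B K' := continuous_const.sub (contDiff_Lc Pr A B).continuous
  exact hc.continuousAt.eventually (Units.isOpen.mem_nhds h)

lemma PK_contDiffAt {K : Fin N → Matrix (Fin k) (Fin d) ℝ} (h : IsUnit (1 - Lc Pr A B K)) :
    ContDiffAt ℝ 2 (PK Pr A B Q R) K := by
  have h1 : ContDiffAt ℝ 2 (fun K' => Ring.inverse (1 - Lc Pr A B K') (srcS Q R K')) K := by
    refine ContDiffAt.clm_apply ?_ (contDiff_srcS Q R).contDiffAt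
    obtain ⟨u, hu⟩ := h
    have h2 : ContDiffAt ℝ 2 (fun K' => 1 - Lc Pr A B K') K :=
      (contDiff_const.sub (contDiff_Lc Pr A B)).contDiffAt
    have h3 : ContDiffAt ℝ 2 Ring.inverse (1 - Lc Pr A B K) := by
      rw [← hu]; exact contDiffAt_ringInverse ℝ u
    exact h3.comp K h2
  refine h1.congr_of_eventuallyEq ?_
  filter_upwards [eventually_unit h] with K' hK'
  exact PK_of_unit hK'

end lyap

section line
variable {d k N : ℕ} (Pr : Matrix (Fin N) (Fin N) ℝ)
    (A : Fin N → Matrix (Fin d) (Fin d) ℝ) (B : Fin N → Matrix (Fin d) (Fin k) ℝ)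
    (Q : Fin N → Matrix (Fin d) (Fin d) ℝ) (R : Fin N → Matrix (Fin k) (Fin k) ℝ)

/-- Source term of the first derivative of the Lyapunov solution. -/
def S1 (K : Fin N → Matrix (Fin k) (Fin d) ℝ) (P : Fin N → Matrix (Fin d) (Fin d) ℝ)
    (E : Fin N → Matrix (Fin k) (Fin d) ℝ) : Fin N → Matrix (Fin d) (Fin d) ℝ :=
  fun i => (E i)ᵀ * R i * K i + (K i)ᵀ * R i * E i
    - (B i * E i)ᵀ * opE Pr P i * Gam A B K i - (Gam A B K i)ᵀ * opE Pr P i * (B i * E i)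

/-- Source term of the second derivative of the Lyapunov solution. -/
def S2 (K : Fin N → Matrix (Fin k) (Fin d) ℝ) (P p : Fin N → Matrix (Fin d) (Fin d) ℝ)
    (E : Fin N → Matrix (Fin k) (Fin d) ℝ) : Fin N → Matrix (Fin d) (Fin d) ℝ :=
  fun i => (2 : ℝ) • ((E i)ᵀ * R i * E i + (B i * E i)ᵀ * opE Pr P i * (B i * E i)
    - (B i * E i)ᵀ * opE Pr p i * Gam A B K i - (Gam A B K i)ᵀ * opE Pr p i * (B i * E i))

lemma hasDerivAt_line (K E : Fin N → Matrix (Fin k) (Fin d) ℝ) (i : Fin N) (t : ℝ) :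
    HasDerivAt (fun s : ℝ => (K + s • E) i) (E i) t := by
  have h : HasDerivAt (fun s : ℝ => K i + s • E i) (0 + (1 : ℝ) • E i) t :=
    (hasDerivAt_const t (K i)).add ((hasDerivAt_id t).smul_const (E i))
  rw [zero_add, one_smul] at h
  exact h

lemma hasDerivAt_Gam (K E : Fin N → Matrix (Fin k) (Fin d) ℝ) (i : Fin N) (t : ℝ) :
    HasDerivAt (fun s : ℝ => Gam A B (K + s • E) i) (-(B i * E i)) t := by
  have h := (hasDerivAt_const t (A i)).sub
    (hasDerivAt_matmul (hasDerivAt_const t (B i)) (hasDerivAt_line K E i t))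
  rw [zero_sub, Matrix.zero_mul, zero_add] at h
  exact h

variable {Pr A B Q R}

lemma eventually_line {K E : Fin N → Matrix (Fin k) (Fin d) ℝ} {t : ℝ}
    (h : IsUnit (1 - Lc Pr A B (K + t • E))) :
    ∀ᶠ s in 𝓝 t, IsUnit (1 - Lc Pr A B (K + s • E)) := by
  have hc : Continuous fun s : ℝ => K + s • E := by fun_prop
  exact hc.continuousAt.eventually (eventually_unit h)

lemma comp_aux {V W : Type*} [NormedAddCommGroup V] [NormedSpace ℝ V] [NormedAddCommGroup W]
    [NormedSpace ℝ W] {g : V → W} {f : ℝ → V} {t : ℝ} (hg : ContDiffAt ℝ 2 g (f t))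
    (hf : ContDiffAt ℝ 2 f t) : ContDiffAt ℝ 2 (fun s => g (f s)) t :=
  ContDiffAt.comp t hg hf

lemma deriv2_aux {V : Type*} [NormedAddCommGroup V] [NormedSpace ℝ V] {f : ℝ → V} {t : ℝ}
    (hf : ContDiffAt ℝ 2 f t) : HasDerivAt (deriv f) (deriv (deriv f) t) t := by
  have h1 : ContDiffAt ℝ 1 (fderiv ℝ f) t := hf.fderiv_right (by norm_num)
  have h2 : ContDiffAt ℝ 1 (fun s => fderiv ℝ f s 1) t := h1.clm_apply contDiffAt_const
  exact (h2.differentiableAt (by norm_num)).hasDerivAt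

lemma contDiffAt_line {K E : Fin N → Matrix (Fin k) (Fin d) ℝ} {t : ℝ}
    (h : IsUnit (1 - Lc Pr A B (K + t • E))) :
    ContDiffAt ℝ 2 (fun s : ℝ => PK Pr A B Q R (K + s • E)) t := by
  have h1 : ContDiffAt ℝ 2 (fun s : ℝ => K + s • E) t :=
    contDiffAt_const.add (contDiffAt_id.smul contDiffAt_const)
  exact comp_aux (PK_contDiffAt h) h1

lemma deriv1_line {K E : Fin N → Matrix (Fin k) (Fin d) ℝ} {t : ℝ}
    (h : IsUnit (1 - Lc Pr A B (K + t • E))) :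
    HasDerivAt (fun s : ℝ => PK Pr A B Q R (K + s • E))
      (deriv (fun s : ℝ => PK Pr A B Q R (K + s • E)) t) t :=
  ((contDiffAt_line h).differentiableAt (by norm_num)).hasDerivAt

lemma deriv2_line {K E : Fin N → Matrix (Fin k) (Fin d) ℝ} {t : ℝ}
    (h : IsUnit (1 - Lc Pr A B (K + t • E))) :
    HasDerivAt (deriv (fun s : ℝ => PK Pr A B Q R (K + s • E)))
      (deriv (deriv (fun s : ℝ => PK Pr A B Q R (K + s • E))) t) t :=
  deriv2_aux (contDiffAt_line h)

lemma deriv1_eq {K E : Fin N → Matrix (Fin k) (Fin d) ℝ} {t : ℝ}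
    (h : IsUnit (1 - Lc Pr A B (K + t • E))) :
    deriv (fun s : ℝ => PK Pr A B Q R (K + s • E)) t =
      S1 Pr A B R (K + t • E) (PK Pr A B Q R (K + t • E)) E
      + Lop Pr (Gam A B (K + t • E)) (deriv (fun s : ℝ => PK Pr A B Q R (K + s • E)) t) := by
  funext i
  have hd := deriv1_line (Q := Q) (R := R) h
  have h1 := hasDerivAt_pi.1 hd i
  have hl := hasDerivAt_line K E i t
  have hg := hasDerivAt_Gam A B K E i t
  have h2 := ((hasDerivAt_const t (Q i)).add (hasDerivAt_matmul (hasDerivAt_matmul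
    (hasDerivAt_transpose hl) (hasDerivAt_const t (R i))) hl)).add
    (hasDerivAt_matmul (hasDerivAt_matmul (hasDerivAt_transpose hg) (hasDerivAt_opE Pr hd i)) hg)
  have heq := HasDerivAt.congr_of_eventuallyEq h2
    (f₁ := fun s => PK Pr A B Q R (K + s • E) i) (by
      filter_upwards [eventually_line h] with s hs
      exact isLyap_of_unit hs i)
  rw [h1.unique heq]
  generalize deriv (fun s : ℝ => PK Pr A B Q R (K + s • E)) t = p1
  generalize K + t • E = Kt
  simp only [Pi.add_apply, S1, Lop_apply, opL, transpose_neg]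
  simp only [Matrix.mul_zero, Matrix.zero_mul, add_zero, zero_add, Matrix.add_mul, Matrix.neg_mul,
    Matrix.mul_neg]
  abel

lemma deriv2_eq {K E : Fin N → Matrix (Fin k) (Fin d) ℝ} {t : ℝ}
    (h : IsUnit (1 - Lc Pr A B (K + t • E))) :
    deriv (deriv (fun s : ℝ => PK Pr A B Q R (K + s • E))) t =
      S2 Pr A B R (K + t • E) (PK Pr A B Q R (K + t • E))
        (deriv (fun s : ℝ => PK Pr A B Q R (K + s • E)) t) E
      + Lop Pr (Gam A B (K + t • E)) (deriv (deriv (fun s : ℝ => PK Pr A B Q R (K + s • E))) t) := by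
  funext i
  have hd := deriv1_line (Q := Q) (R := R) h
  have hd2 := deriv2_line (Q := Q) (R := R) h
  have h1 := hasDerivAt_pi.1 hd2 i
  have hl := hasDerivAt_line K E i t
  have hg := hasDerivAt_Gam A B K E i t
  have hE := hasDerivAt_const t (E i)
  have hBE := hasDerivAt_const t (B i * E i)
  have hR := hasDerivAt_const t (R i)
  have hP := hasDerivAt_opE Pr hd i
  have hP2 := hasDerivAt_opE Pr hd2 i
  have h2 := ((((hasDerivAt_matmul (hasDerivAt_matmul (hasDerivAt_transpose hE) hR) hl).add
    (hasDerivAt_matmul (hasDerivAt_matmul (hasDerivAt_transpose hl) hR) hE)).sub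
    (hasDerivAt_matmul (hasDerivAt_matmul (hasDerivAt_transpose hBE) hP) hg)).sub
    (hasDerivAt_matmul (hasDerivAt_matmul (hasDerivAt_transpose hg) hP) hBE)).add
    (hasDerivAt_matmul (hasDerivAt_matmul (hasDerivAt_transpose hg) hP2) hg)
  have heq := HasDerivAt.congr_of_eventuallyEq h2
    (f₁ := fun s => deriv (fun s : ℝ => PK Pr A B Q R (K + s • E)) s i) (by
      filter_upwards [eventually_line h] with s hs
      exact congrFun (deriv1_eq hs) i)
  rw [h1.unique heq]
  generalize deriv (deriv (fun s : ℝ => PK Pr A B Q R (K + s • E))) t = p2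
  generalize deriv (fun s : ℝ => PK Pr A B Q R (K + s • E)) t = p1
  generalize K + t • E = Kt
  simp only [Pi.add_apply, S2, Lop_apply, opL, transpose_neg, transpose_zero]
  rw [two_smul]
  simp only [Matrix.mul_zero, Matrix.zero_mul, add_zero, zero_add, Matrix.add_mul, Matrix.neg_mul,
    Matrix.mul_neg]
  abel
end line

/-- Standing assumptions bundled together. -/
structure Hyp {d k N : ℕ} (Pr : Matrix (Fin N) (Fin N) ℝ)
    (Q : Fin N → Matrix (Fin d) (Fin d) ℝ) (R : Fin N → Matrix (Fin k) (Fin k) ℝ)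
    (piv : Fin N → ℝ) (Sg : Matrix (Fin d) (Fin d) ℝ) : Prop where
  hd : 0 < d
  hk : 0 < k
  hN : 0 < N
  hPr : ∀ i j, 0 ≤ Pr i j
  hPrSum : ∀ i, ∑ j, Pr i j = 1
  hpiv : ∀ i, 0 < piv i
  hSg : Sg.PosDef
  hQ : ∀ i, (Q i).PosDef
  hR : ∀ i, (R i).PosDef

/-- Initial second moments. -/
def X0 {d N : ℕ} (piv : Fin N → ℝ) (Sg : Matrix (Fin d) (Fin d) ℝ) :
    Fin N → Matrix (Fin d) (Fin d) ℝ := fun i => piv i • Sg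

section good
variable {d k N : ℕ} {Pr : Matrix (Fin N) (Fin N) ℝ}
    {A : Fin N → Matrix (Fin d) (Fin d) ℝ} {B : Fin N → Matrix (Fin d) (Fin k) ℝ}
    {Q : Fin N → Matrix (Fin d) (Fin d) ℝ} {R : Fin N → Matrix (Fin k) (Fin k) ℝ}
    {piv : Fin N → ℝ} {Sg : Matrix (Fin d) (Fin d) ℝ}

lemma cost_eq (K : Fin N → Matrix (Fin k) (Fin d) ℝ) :
    cost Pr A B Q R piv Sg K = pair (X0 piv Sg) (PK Pr A B Q R K) := by
  unfold cost pair X0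
  refine Finset.sum_congr rfl fun i _ => ?_
  rw [Matrix.smul_mul, Matrix.trace_smul, Matrix.trace_mul_comm, smul_eq_mul]

lemma Hyp.psdQ (H : Hyp Pr Q R piv Sg) (i : Fin N) : PSD (Q i) := psd_of_posSemidef (H.hQ i).posSemidef
lemma Hyp.psdR (H : Hyp Pr Q R piv Sg) (i : Fin N) : PSD (R i) := psd_of_posSemidef (H.hR i).posSemidef
lemma Hyp.psdX0 (H : Hyp Pr Q R piv Sg) (i : Fin N) : PSD (X0 piv Sg i) :=
  (psd_of_posSemidef H.hSg.posSemidef).smul (H.hpiv i).le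
lemma Hyp.mu0 (H : Hyp Pr Q R piv Sg) : 0 < mu piv Sg := mu_pos H.hd H.hN H.hpiv H.hSg
lemma Hyp.lamQ (H : Hyp Pr Q R piv Sg) : 0 < lamMin Q := lamMin_pos H.hd H.hN H.hQ
lemma Hyp.lamR (H : Hyp Pr Q R piv Sg) : 0 < lamMin R := lamMin_pos H.hk H.hN H.hR
lemma Hyp.muX0 (H : Hyp Pr Q R piv Sg) (i : Fin N) (x : Fin d → ℝ) :
    mu piv Sg * (x ⬝ᵥ x) ≤ x ⬝ᵥ X0 piv Sg i *ᵥ x := mu_quad H.hd H.hpiv H.hSg i x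

lemma Hyp.psd_src (H : Hyp Pr Q R piv Sg) (K : Fin N → Matrix (Fin k) (Fin d) ℝ) (i : Fin N) :
    PSD (srcS Q R K i) := (H.psdQ i).add ((H.psdR i).conj (K i))

variable (Pr A B Q R piv Sg) in
/-- Policies with a positive semidefinite Lyapunov solution of cost at most `β`. -/
def Good (β : ℝ) (K : Fin N → Matrix (Fin k) (Fin d) ℝ) : Prop :=
  ∃ P, (∀ i, PSD (P i)) ∧ IsLyap Pr A B Q R K P ∧ pair (X0 piv Sg) P ≤ β

lemma trace_le_pair (H : Hyp Pr Q R piv Sg) {P : Fin N → Matrix (Fin d) (Fin d) ℝ}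
    (hP : ∀ i, PSD (P i)) (i : Fin N) : mu piv Sg * (P i).trace ≤ pair (X0 piv Sg) P := by
  have h1 : mu piv Sg * (P i).trace ≤ (X0 piv Sg i * P i).trace := by
    rw [Matrix.trace_mul_comm]
    have := trace_mul_mono (hP i) (M := mu piv Sg • 1) (M' := X0 piv Sg i) (fun x => by
      rw [Matrix.smul_mulVec, Matrix.one_mulVec, dotProduct_smul, smul_eq_mul]
      exact H.muX0 i x)
    rwa [Matrix.mul_smul, Matrix.mul_one, Matrix.trace_smul, smul_eq_mul] at this
  refine h1.trans ?_
  unfold pair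
  exact Finset.single_le_sum (f := fun i => (X0 piv Sg i * P i).trace)
    (fun j _ => trace_mul_nonneg (H.psdX0 j) (hP j).2) (Finset.mem_univ i)

lemma lyap_upper (H : Hyp Pr Q R piv Sg) {P : Fin N → Matrix (Fin d) (Fin d) ℝ}
    (hP : ∀ i, PSD (P i)) {β : ℝ} (hβ : pair (X0 piv Sg) P ≤ β) (i : Fin N) (x : Fin d → ℝ) :
    x ⬝ᵥ P i *ᵥ x ≤ β / mu piv Sg * (x ⬝ᵥ x) := by
  have h1 := trace_le_pair H hP i
  have h2 : (P i).trace ≤ β / mu piv Sg := by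
    rw [le_div_iff₀ H.mu0, mul_comm]; exact h1.trans hβ
  exact (quad_le_trace (hP i) x).trans (mul_le_mul_of_nonneg_right h2 (dot_self_nonneg x))

lemma lyap_ge_Q (H : Hyp Pr Q R piv Sg) {K : Fin N → Matrix (Fin k) (Fin d) ℝ}
    {P : Fin N → Matrix (Fin d) (Fin d) ℝ}
    (hP : ∀ i, PSD (P i)) (hL : IsLyap Pr A B Q R K P) (i : Fin N) (x : Fin d → ℝ) :
    x ⬝ᵥ Q i *ᵥ x + x ⬝ᵥ Lop Pr (Gam A B K) P i *ᵥ x ≤ x ⬝ᵥ P i *ᵥ x := by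
  have h : P i = Q i + (K i)ᵀ * R i * K i + Lop Pr (Gam A B K) P i := hL i
  conv_rhs => rw [h]
  rw [Matrix.add_mulVec, Matrix.add_mulVec, dotProduct_add, dotProduct_add]
  have := ((H.psdR i).conj (K i)).2 x
  linarith

lemma lyap_lower (H : Hyp Pr Q R piv Sg) {K : Fin N → Matrix (Fin k) (Fin d) ℝ}
    {P : Fin N → Matrix (Fin d) (Fin d) ℝ}
    (hP : ∀ i, PSD (P i)) (hL : IsLyap Pr A B Q R K P) (i : Fin N) (x : Fin d → ℝ) :
    lamMin Q * (x ⬝ᵥ x) ≤ x ⬝ᵥ P i *ᵥ x := by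
  have h1 := lyap_ge_Q H hP hL i x
  have h2 := (psd_Lop H.hPr (Gam A B K) P hP i).2 x
  have h3 := lamMin_quad H.hQ i x
  linarith

lemma exists_ne (H : Hyp Pr Q R piv Sg) : ∃ x : Fin d → ℝ, x ⬝ᵥ x = 1 := by
  refine ⟨Pi.single ⟨0, H.hd⟩ 1, ?_⟩
  simp

lemma lam_le (H : Hyp Pr Q R piv Sg) {K : Fin N → Matrix (Fin k) (Fin d) ℝ}
    {P : Fin N → Matrix (Fin d) (Fin d) ℝ}
    (hP : ∀ i, PSD (P i)) (hL : IsLyap Pr A B Q R K P) {β : ℝ} (hβ : pair (X0 piv Sg) P ≤ β) :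
    lamMin Q ≤ β / mu piv Sg := by
  obtain ⟨x, hx⟩ := exists_ne H
  have h1 := lyap_lower H hP hL ⟨0, H.hN⟩ x
  have h2 := lyap_upper H hP hβ ⟨0, H.hN⟩ x
  rw [hx] at h1 h2
  linarith

lemma lyap_stab (H : Hyp Pr Q R piv Sg) {K : Fin N → Matrix (Fin k) (Fin d) ℝ}
    {P : Fin N → Matrix (Fin d) (Fin d) ℝ}
    (hP : ∀ i, PSD (P i)) (hL : IsLyap Pr A B Q R K P) : Stab (Lop Pr (Gam A B K)) := by
  set a := pair (X0 piv Sg) P / mu piv Sg with ha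
  have hla : lamMin Q ≤ a := lam_le H hP hL le_rfl
  have hl := H.lamQ
  have ha0 : 0 < a := hl.trans_le hla
  refine stab_of_cert H.hPr (P := P) (l := lamMin Q) (c := 1 - lamMin Q / a) hl ?_ ?_
    (lyap_lower H hP hL) ?_
  · have := (div_le_one ha0).2 hla
    linarith
  · have := div_pos hl ha0
    linarith
  · intro i x
    have h1 := lyap_ge_Q H hP hL i x
    have h2 := lyap_upper H hP le_rfl i x
    have h3 := lamMin_quad H.hQ i x
    rw [← ha] at h2
    have h4 : lamMin Q / a * (x ⬝ᵥ P i *ᵥ x) ≤ lamMin Q / a * (a * (x ⬝ᵥ x)) :=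
      mul_le_mul_of_nonneg_left h2 (div_pos hl ha0).le
    have h5 : lamMin Q / a * (a * (x ⬝ᵥ x)) = lamMin Q * (x ⬝ᵥ x) := by
      field_simp
    rw [sub_mul, one_mul]
    linarith

lemma good_of_stab (H : Hyp Pr Q R piv Sg) {K : Fin N → Matrix (Fin k) (Fin d) ℝ}
    (h : Stab (Lop Pr (Gam A B K))) : IsLyap Pr A B Q R K (PK Pr A B Q R K) ∧
      (∀ i, PSD (PK Pr A B Q R K i)) := by
  have h1 : IsLyap Pr A B Q R K (PK Pr A B Q R K) := isLyap_of_unit (isUnit_of_stab h)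
  exact ⟨h1, h.psd (psd_Lop H.hPr _) ((isLyap_iff _ _ _ _ _ _ _).1 h1) (H.psd_src K)⟩

/-- Everything known about a good policy. -/
structure GoodSpec (Pr : Matrix (Fin N) (Fin N) ℝ)
    (A : Fin N → Matrix (Fin d) (Fin d) ℝ) (B : Fin N → Matrix (Fin d) (Fin k) ℝ)
    (Q : Fin N → Matrix (Fin d) (Fin d) ℝ) (R : Fin N → Matrix (Fin k) (Fin k) ℝ)
    (piv : Fin N → ℝ) (Sg : Matrix (Fin d) (Fin d) ℝ) (β : ℝ)
    (K : Fin N → Matrix (Fin k) (Fin d) ℝ) : Prop where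
  stab : Stab (Lop Pr (Gam A B K))
  unit : IsUnit (1 - Lc Pr A B K)
  lyap : IsLyap Pr A B Q R K (PK Pr A B Q R K)
  psd : ∀ i, PSD (PK Pr A B Q R K i)
  pairle : pair (X0 piv Sg) (PK Pr A B Q R K) ≤ β

lemma Good.spec (H : Hyp Pr Q R piv Sg) {β : ℝ} {K : Fin N → Matrix (Fin k) (Fin d) ℝ}
    (h : Good Pr A B Q R piv Sg β K) : GoodSpec Pr A B Q R piv Sg β K := by
  obtain ⟨P, hP, hL, hβ⟩ := h
  have hs := lyap_stab H hP hL
  have hu := isUnit_of_stab hs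
  have hPK : PK Pr A B Q R K = P := PK_unique hu hL
  refine ⟨hs, hu, ?_, ?_, ?_⟩ <;> rw [hPK] <;> assumption

lemma GoodSpec.good {β : ℝ} {K : Fin N → Matrix (Fin k) (Fin d) ℝ}
    (h : GoodSpec Pr A B Q R piv Sg β K) : Good Pr A B Q R piv Sg β K :=
  ⟨_, h.psd, h.lyap, h.pairle⟩

/-- Properties of the aggregated second moment. -/
lemma exists_X (H : Hyp Pr Q R piv Sg) {Γ : Fin N → Matrix (Fin d) (Fin d) ℝ}
    (h : Stab (Lop Pr Γ)) : ∃ X, X = X0 piv Sg + Top Pr Γ X ∧ (∀ i, PSD (X i)) := by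
  obtain ⟨X, hX⟩ := h.dual.exists_sol (X0 piv Sg)
  exact ⟨X, hX, h.dual.psd (psd_Top H.hPr _) hX H.psdX0⟩

lemma X_ge (H : Hyp Pr Q R piv Sg) {Γ X : Fin N → Matrix (Fin d) (Fin d) ℝ}
    (hX : X = X0 piv Sg + Top Pr Γ X) (hp : ∀ i, PSD (X i)) (i : Fin N) (x : Fin d → ℝ) :
    mu piv Sg * (x ⬝ᵥ x) ≤ x ⬝ᵥ X i *ᵥ x := by
  have h1 : X i = X0 piv Sg i + Top Pr Γ X i := congrFun hX i
  rw [h1, Matrix.add_mulVec, dotProduct_add]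
  have := (psd_Top H.hPr Γ X hp i).2 x
  have := H.muX0 i x
  linarith

lemma psd_trace_nonneg {a : ℕ} {M : Matrix (Fin a) (Fin a) ℝ} (h : PSD M) : 0 ≤ M.trace := by
  have := trace_mul_nonneg h (M := 1) (fun x => by rw [Matrix.one_mulVec]; exact dot_self_nonneg x)
  rwa [Matrix.mul_one] at this

lemma X_trace (H : Hyp Pr Q R piv Sg) {β : ℝ} {K : Fin N → Matrix (Fin k) (Fin d) ℝ}
    (hg : GoodSpec Pr A B Q R piv Sg β K) {X : Fin N → Matrix (Fin d) (Fin d) ℝ}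
    (hX : X = X0 piv Sg + Top Pr (Gam A B K) X) (hp : ∀ i, PSD (X i)) :
    ∑ i, (X i).trace ≤ β / lamMin Q := by
  have h1 := pair_sol hX ((isLyap_iff _ _ _ _ _ _ _).1 hg.lyap)
  have h2 : pair X (fun _ => lamMin Q • (1 : Matrix (Fin d) (Fin d) ℝ)) ≤ pair X (srcS Q R K) := by
    refine pair_mono hp fun i x => ?_
    rw [Matrix.smul_mulVec, Matrix.one_mulVec, dotProduct_smul, smul_eq_mul]
    unfold srcS
    rw [Matrix.add_mulVec, dotProduct_add]
    have := ((H.psdR i).conj (K i)).2 x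
    have := lamMin_quad H.hQ i x
    linarith
  have h3 : pair X (fun _ => lamMin Q • (1 : Matrix (Fin d) (Fin d) ℝ)) = lamMin Q * ∑ i, (X i).trace := by
    unfold pair
    rw [Finset.mul_sum]
    refine Finset.sum_congr rfl fun i _ => ?_
    rw [Matrix.mul_smul, Matrix.mul_one, Matrix.trace_smul, smul_eq_mul]
  rw [le_div_iff₀ H.lamQ, mul_comm, ← h3]
  exact h2.trans (h1 ▸ hg.pairle)

lemma X_Gam_trace (H : Hyp Pr Q R piv Sg) {Γ X : Fin N → Matrix (Fin d) (Fin d) ℝ}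
    (hX : X = X0 piv Sg + Top Pr Γ X) :
    ∑ i, (Γ i * X i * (Γ i)ᵀ).trace ≤ ∑ i, (X i).trace := by
  have h1 : ∑ i, (X i).trace = ∑ i, (X0 piv Sg i).trace + ∑ j, (Top Pr Γ X j).trace := by
    rw [← Finset.sum_add_distrib]
    refine Finset.sum_congr rfl fun i _ => ?_
    rw [← Matrix.trace_add]
    exact congrArg Matrix.trace (congrFun hX i)
  have h2 : ∑ j, (Top Pr Γ X j).trace = ∑ i, (Γ i * X i * (Γ i)ᵀ).trace := by
    simp only [Top_apply, opT, Matrix.trace_sum, Matrix.trace_smul, smul_eq_mul]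
    rw [Finset.sum_comm]
    refine Finset.sum_congr rfl fun i _ => ?_
    rw [← Finset.sum_mul, H.hPrSum, one_mul]
  rw [h1, h2]
  have : 0 ≤ ∑ i, (X0 piv Sg i).trace := Finset.sum_nonneg fun i _ => psd_trace_nonneg (H.psdX0 i)
  linarith
end good

section grad
variable {d k N : ℕ} {Pr : Matrix (Fin N) (Fin N) ℝ}
    {A : Fin N → Matrix (Fin d) (Fin d) ℝ} {B : Fin N → Matrix (Fin d) (Fin k) ℝ}
    {Q : Fin N → Matrix (Fin d) (Fin d) ℝ} {R : Fin N → Matrix (Fin k) (Fin k) ℝ}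
    {piv : Fin N → ℝ} {Sg : Matrix (Fin d) (Fin d) ℝ}

lemma pair_expand (V W : Fin N → Matrix (Fin d) (Fin d) ℝ) :
    pair V W = ∑ i, ∑ a, ∑ b, V i a b * W i b a := by
  simp only [pair, Matrix.trace, Matrix.diag, Matrix.mul_apply]

lemma pair_hasDerivAt (V : Fin N → Matrix (Fin d) (Fin d) ℝ)
    {f : ℝ → Fin N → Matrix (Fin d) (Fin d) ℝ} {f' : Fin N → Matrix (Fin d) (Fin d) ℝ}
    {t : ℝ} (hf : HasDerivAt f f' t) : HasDerivAt (fun s => pair V (f s)) (pair V f') t := by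
  simp only [pair_expand]
  have h := fun i a b => hasDerivAt_pi.1 (hasDerivAt_pi.1 (hasDerivAt_pi.1 hf i) b) a
  exact HasDerivAt.fun_sum fun i _ => HasDerivAt.fun_sum fun a _ => HasDerivAt.fun_sum fun b _ =>
    (h i a b).const_mul _

lemma pair_differentiableAt {F : Type*} [NormedAddCommGroup F] [NormedSpace ℝ F]
    (V : Fin N → Matrix (Fin d) (Fin d) ℝ)
    {f : F → Fin N → Matrix (Fin d) (Fin d) ℝ}
    {t : F} (hf : DifferentiableAt ℝ f t) : DifferentiableAt ℝ (fun s => pair V (f s)) t := by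
  simp only [pair_expand]
  have h := fun i a b => differentiableAt_pi.1 (differentiableAt_pi.1 (differentiableAt_pi.1 hf i) b) a
  exact DifferentiableAt.fun_sum fun i _ => DifferentiableAt.fun_sum fun a _ =>
    DifferentiableAt.fun_sum fun b _ => (h i a b).const_mul _

lemma fderiv_line {V : Type*} [NormedAddCommGroup V] [NormedSpace ℝ V] {f : V → ℝ} {x : V}
    (h : DifferentiableAt ℝ f x) (v : V) :
    HasDerivAt (fun t : ℝ => f (x + t • v)) (fderiv ℝ f x v) 0 := by
  have h1 : HasFDerivAt f (fderiv ℝ f x) (x + (0 : ℝ) • v) := by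
    rw [zero_smul, add_zero]; exact h.hasFDerivAt
  have h2 : HasDerivAt (fun t : ℝ => x + t • v) ((1 : ℝ) • v) 0 :=
    ((hasDerivAt_id (0 : ℝ)).smul_const v).const_add x
  rw [one_smul] at h2
  exact h1.comp_hasDerivAt (0 : ℝ) h2

variable (Pr A B R) in
/-- Half of the natural gradient. -/
def Lmat (K : Fin N → Matrix (Fin k) (Fin d) ℝ) (P : Fin N → Matrix (Fin d) (Fin d) ℝ) :
    Fin N → Matrix (Fin k) (Fin d) ℝ :=
  fun i => R i * K i - (B i)ᵀ * opE Pr P i * Gam A B K i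

lemma S1_eq (H : Hyp Pr Q R piv Sg) {K : Fin N → Matrix (Fin k) (Fin d) ℝ}
    {P : Fin N → Matrix (Fin d) (Fin d) ℝ} (hP : ∀ i, PSD (P i))
    (E : Fin N → Matrix (Fin k) (Fin d) ℝ) (i : Fin N) :
    S1 Pr A B R K P E i = (E i)ᵀ * Lmat Pr A B R K P i + (Lmat Pr A B R K P i)ᵀ * E i := by
  have h1 : (opE Pr P i)ᵀ = opE Pr P i := (psd_opE H.hPr hP i).1
  have h2 : (R i)ᵀ = R i := (H.psdR i).1
  simp only [S1, Lmat, transpose_sub, transpose_mul, transpose_transpose, h1, h2, Matrix.mul_sub,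
    Matrix.sub_mul, Matrix.mul_assoc]
  abel

lemma S1_quad (H : Hyp Pr Q R piv Sg) {K : Fin N → Matrix (Fin k) (Fin d) ℝ}
    {P : Fin N → Matrix (Fin d) (Fin d) ℝ} (hP : ∀ i, PSD (P i))
    (E : Fin N → Matrix (Fin k) (Fin d) ℝ) (i : Fin N) (x : Fin d → ℝ) :
    x ⬝ᵥ S1 Pr A B R K P E i *ᵥ x = 2 * ((E i *ᵥ x) ⬝ᵥ (Lmat Pr A B R K P i *ᵥ x)) := by
  rw [S1_eq H hP, Matrix.add_mulVec, dotProduct_add, quad_mul, quad_mul,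
    dotProduct_comm (Lmat Pr A B R K P i *ᵥ x)]
  ring

lemma diff_formula {K K' : Fin N → Matrix (Fin k) (Fin d) ℝ}
    {P P' : Fin N → Matrix (Fin d) (Fin d) ℝ} (hL : IsLyap Pr A B Q R K P)
    (hL' : IsLyap Pr A B Q R K' P') :
    P' - P = (fun i => S1 Pr A B R K P (K' - K) i + ((K' - K) i)ᵀ * R i * (K' - K) i
      + (B i * (K' - K) i)ᵀ * opE Pr P i * (B i * (K' - K) i)) + Lop Pr (Gam A B K') (P' - P) := by
  obtain ⟨D, rfl⟩ : ∃ D, K' = K + D := ⟨K' - K, by abel⟩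
  rw [add_sub_cancel_left, map_sub]
  funext i
  have h1 := hL i
  have h2 := hL' i
  have hG : Gam A B (K + D) i = Gam A B K i - B i * D i := by
    simp only [Gam, Pi.add_apply, Matrix.mul_add]; abel
  simp only [Pi.add_apply, Pi.sub_apply, Lop_apply, opL, S1]
  rw [hG, Pi.add_apply] at h2
  rw [hG]
  conv_lhs => rw [h1, h2]
  simp only [transpose_sub, transpose_add, Matrix.mul_sub, Matrix.sub_mul, Matrix.mul_add,
    Matrix.add_mul]
  abel

lemma norm2sq_nonneg {a b : ℕ} (V : Fin N → Matrix (Fin a) (Fin b) ℝ) : 0 ≤ norm2sq V := by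
  refine Finset.sum_nonneg fun i _ => psd_trace_nonneg ⟨?_, fun x => ?_⟩
  · rw [transpose_mul, transpose_transpose]
  · rw [quad_mul]; exact dot_self_nonneg _

lemma psd_gram {a b : ℕ} (V : Matrix (Fin a) (Fin b) ℝ) : PSD (Vᵀ * V) := by
  refine ⟨?_, fun x => ?_⟩
  · rw [transpose_mul, transpose_transpose]
  · rw [quad_mul]; exact dot_self_nonneg _

lemma pair_gram_le {X : Fin N → Matrix (Fin d) (Fin d) ℝ} {m : ℝ}
    (h : ∀ i x, x ⬝ᵥ X i *ᵥ x ≤ m * (x ⬝ᵥ x)) (V : Fin N → Matrix (Fin k) (Fin d) ℝ) :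
    pair X (fun i => (V i)ᵀ * V i) ≤ m * norm2sq V := by
  unfold pair norm2sq
  rw [Finset.mul_sum]
  refine Finset.sum_le_sum fun i _ => ?_
  rw [Matrix.trace_mul_comm]
  have := trace_mul_mono (psd_gram (V i)) (M := X i) (M' := m • 1) (fun x => by
    rw [Matrix.smul_mulVec, Matrix.one_mulVec, dotProduct_smul, smul_eq_mul]
    exact h i x)
  rwa [Matrix.mul_smul, Matrix.mul_one, Matrix.trace_smul, smul_eq_mul] at this

lemma grad_dom (H : Hyp Pr Q R piv Sg) {K Ks : Fin N → Matrix (Fin k) (Fin d) ℝ}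
    {P P' X : Fin N → Matrix (Fin d) (Fin d) ℝ} (hP : ∀ i, PSD (P i)) (hL : IsLyap Pr A B Q R K P)
    (hL' : IsLyap Pr A B Q R Ks P') (hX : X = X0 piv Sg + Top Pr (Gam A B Ks) X)
    (hXp : ∀ i, PSD (X i)) :
    pair (X0 piv Sg) P - pair (X0 piv Sg) P' ≤ maxNorm X / lamMin R * norm2sq (Lmat Pr A B R K P) := by
  have h1 := pair_sol hX (diff_formula hL hL')
  have hr := H.lamR
  have h2 : pair X (-(lamMin R)⁻¹ • fun i => (Lmat Pr A B R K P i)ᵀ * Lmat Pr A B R K P i) ≤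
      pair X (fun i => S1 Pr A B R K P (Ks - K) i + ((Ks - K) i)ᵀ * R i * (Ks - K) i
      + (B i * (Ks - K) i)ᵀ * opE Pr P i * (B i * (Ks - K) i)) := by
    refine pair_mono hXp fun i x => ?_
    rw [Pi.smul_apply, Matrix.smul_mulVec, dotProduct_smul, smul_eq_mul, quad_mul,
      Matrix.add_mulVec, Matrix.add_mulVec, dotProduct_add, dotProduct_add, S1_quad H hP, quad_conj]
    have h3 := ((psd_opE H.hPr hP i).conj (B i * (Ks - K) i)).2 x
    set u := (Ks - K) i *ᵥ x
    set v := Lmat Pr A B R K P i *ᵥ x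
    have h4 := lamMin_quad H.hR i u
    have h5 := dot_self_nonneg (u + (lamMin R)⁻¹ • v)
    rw [add_dotProduct, dotProduct_add, dotProduct_add, smul_dotProduct, smul_dotProduct,
      dotProduct_smul, dotProduct_smul, dotProduct_comm v u] at h5
    simp only [smul_eq_mul] at h5
    have h6 := mul_nonneg hr.le h5
    have h7 : lamMin R * (u ⬝ᵥ u + (lamMin R)⁻¹ * u ⬝ᵥ v + ((lamMin R)⁻¹ * u ⬝ᵥ v +
        (lamMin R)⁻¹ * ((lamMin R)⁻¹ * v ⬝ᵥ v))) = lamMin R * (u ⬝ᵥ u) + 2 * (u ⬝ᵥ v) +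
        (lamMin R)⁻¹ * (v ⬝ᵥ v) := by
      field_simp; ring
    linarith
  rw [pair_smul_right, ← h1] at h2
  have h8 := pair_gram_le (maxNorm_quad X) (Lmat Pr A B R K P)
  have h9 := mul_le_mul_of_nonneg_left h8 (inv_pos.2 hr).le
  have h10 : pair (X0 piv Sg) P' = pair (X0 piv Sg) (P' - P) + pair (X0 piv Sg) P := by
    rw [← pair_add_right, sub_add_cancel]
  have h11 : maxNorm X / lamMin R * norm2sq (Lmat Pr A B R K P) =
    (lamMin R)⁻¹ * (maxNorm X * norm2sq (Lmat Pr A B R K P)) := by ring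
  linarith

lemma pair_S1 (H : Hyp Pr Q R piv Sg) {K : Fin N → Matrix (Fin k) (Fin d) ℝ}
    {P X : Fin N → Matrix (Fin d) (Fin d) ℝ} (hP : ∀ i, PSD (P i)) (hXp : ∀ i, PSD (X i))
    (E : Fin N → Matrix (Fin k) (Fin d) ℝ) :
    pair X (S1 Pr A B R K P E) = ip (fun i => (2 : ℝ) • (Lmat Pr A B R K P i * X i)) E := by
  unfold pair ip
  refine Finset.sum_congr rfl fun i _ => ?_
  rw [S1_eq H hP, Matrix.mul_add, Matrix.trace_add, transpose_smul, transpose_mul, (hXp i).1,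
    Matrix.smul_mul, Matrix.trace_smul, smul_eq_mul, two_mul, Matrix.mul_assoc]
  congr 1
  rw [← Matrix.trace_transpose, transpose_mul, transpose_mul, transpose_transpose, (hXp i).1,
    Matrix.trace_mul_comm]

lemma deriv_cost_line {K E : Fin N → Matrix (Fin k) (Fin d) ℝ} {t : ℝ}
    (h : IsUnit (1 - Lc Pr A B (K + t • E))) :
    HasDerivAt (fun s : ℝ => cost Pr A B Q R piv Sg (K + s • E))
      (pair (X0 piv Sg) (deriv (fun s : ℝ => PK Pr A B Q R (K + s • E)) t)) t := by
  simp only [cost_eq]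
  exact pair_hasDerivAt _ (deriv1_line h)

lemma cost_differentiableAt {K : Fin N → Matrix (Fin k) (Fin d) ℝ}
    (h : IsUnit (1 - Lc Pr A B K)) : DifferentiableAt ℝ (cost Pr A B Q R piv Sg) K := by
  have h1 : DifferentiableAt ℝ (fun K => pair (X0 piv Sg) (PK Pr A B Q R K)) K :=
    pair_differentiableAt _ ((PK_contDiffAt h).differentiableAt (by norm_num))
  have h2 : cost Pr A B Q R piv Sg = fun K => pair (X0 piv Sg) (PK Pr A B Q R K) := funext cost_eq
  rw [h2]; exact h1

lemma ip_sub_left {a b : ℕ} (U V W : Fin N → Matrix (Fin a) (Fin b) ℝ) :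
    ip (U - V) W = ip U W - ip V W := by
  unfold ip
  rw [← Finset.sum_sub_distrib]
  refine Finset.sum_congr rfl fun i _ => ?_
  rw [Pi.sub_apply, transpose_sub, Matrix.sub_mul, Matrix.trace_sub]

lemma eq_zero_of_norm2sq {a b : ℕ} {V : Fin N → Matrix (Fin a) (Fin b) ℝ} (h : norm2sq V = 0) :
    V = 0 := by
  funext i
  have h1 := (Finset.sum_eq_zero_iff_of_nonneg
    (fun i _ => psd_trace_nonneg (psd_gram (V i)))).1 h i (Finset.mem_univ i)
  have := Matrix.trace_conjTranspose_mul_self_eq_zero_iff (A := V i)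
  rw [Matrix.conjTranspose_eq_transpose_of_trivial] at this
  exact this.1 h1

lemma grad_formula (H : Hyp Pr Q R piv Sg) {β : ℝ} {K : Fin N → Matrix (Fin k) (Fin d) ℝ}
    (hg : GoodSpec Pr A B Q R piv Sg β K) {G : Fin N → Matrix (Fin k) (Fin d) ℝ}
    (hG : ∀ E : Fin N → Matrix (Fin k) (Fin d) ℝ, fderiv ℝ (cost Pr A B Q R piv Sg) K E = ip G E) :
    4 * mu piv Sg ^ 2 * norm2sq (Lmat Pr A B R K (PK Pr A B Q R K)) ≤ norm2sq G := by
  obtain ⟨X, hX, hXp⟩ := exists_X H hg.stab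
  set Lm := Lmat Pr A B R K (PK Pr A B Q R K) with hLm
  have key : ∀ E, ip G E = ip (fun i => (2 : ℝ) • (Lm i * X i)) E := by
    intro E
    have hu : IsUnit (1 - Lc Pr A B (K + (0 : ℝ) • E)) := by
      rw [zero_smul, add_zero]; exact hg.unit
    have h1 := fderiv_line (cost_differentiableAt (Q := Q) (R := R) (piv := piv) (Sg := Sg) hg.unit) E
    have h2 : ip G E = _ := (hG E).symm.trans (h1.unique (deriv_cost_line hu))
    have h3 := deriv1_eq (Q := Q) (R := R) hu
    rw [zero_smul, add_zero] at h3
    rw [h2, pair_sol hX h3, pair_S1 H hg.psd hXp]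
  have hGe : G = fun i => (2 : ℝ) • (Lm i * X i) := by
    have h4 : norm2sq (G - fun i => (2 : ℝ) • (Lm i * X i)) = 0 := by
      have h5 := ip_sub_left G (fun i => (2 : ℝ) • (Lm i * X i)) (G - fun i => (2 : ℝ) • (Lm i * X i))
      rw [key, sub_self] at h5
      exact h5
    exact sub_eq_zero.1 (eq_zero_of_norm2sq h4)
  rw [hGe]
  unfold norm2sq
  rw [Finset.mul_sum]
  refine Finset.sum_le_sum fun i _ => ?_
  rw [transpose_smul, Matrix.smul_mul, Matrix.mul_smul, Matrix.trace_smul, Matrix.trace_smul,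
    smul_eq_mul, smul_eq_mul, transpose_mul, (hXp i).1]
  have h6 : (X i * (Lm i)ᵀ * (Lm i * X i)).trace = ((Lm i)ᵀ * Lm i * (X i * X i)).trace := by
    rw [Matrix.mul_assoc, Matrix.trace_mul_comm]
    simp only [Matrix.mul_assoc]
  rw [h6]
  have h7 := trace_mul_mono (psd_gram (Lm i)) (M := mu piv Sg ^ 2 • 1) (M' := X i * X i) (fun x => by
    rw [Matrix.smul_mulVec, Matrix.one_mulVec, dotProduct_smul, smul_eq_mul]
    have h8 : x ⬝ᵥ (X i * X i) *ᵥ x = (X i *ᵥ x) ⬝ᵥ (X i *ᵥ x) := by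
      conv_lhs => rw [← (hXp i).1]
      rw [(hXp i).1]
      have := quad_mul (X i) (X i) x x
      rwa [(hXp i).1] at this
    rw [h8]
    have h9 := dot_self_nonneg (X i *ᵥ x - mu piv Sg • x)
    rw [sub_dotProduct, dotProduct_sub, dotProduct_sub, smul_dotProduct, smul_dotProduct,
      dotProduct_smul, dotProduct_smul, dotProduct_comm (X i *ᵥ x) x] at h9
    simp only [smul_eq_mul] at h9
    have h10 := mul_le_mul_of_nonneg_left (X_ge H hX hXp i x) H.mu0.le
    nlinarith)
  rw [Matrix.mul_smul, Matrix.mul_one, Matrix.trace_smul, smul_eq_mul] at h7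
  linarith
end grad

section hess
variable {d k N : ℕ} {Pr : Matrix (Fin N) (Fin N) ℝ}
    {A : Fin N → Matrix (Fin d) (Fin d) ℝ} {B : Fin N → Matrix (Fin d) (Fin k) ℝ}
    {Q : Fin N → Matrix (Fin d) (Fin d) ℝ} {R : Fin N → Matrix (Fin k) (Fin k) ℝ}
    {piv : Fin N → ℝ} {Sg : Matrix (Fin d) (Fin d) ℝ}

lemma quad_expand {a : ℕ} {M : Matrix (Fin a) (Fin a) ℝ} (hM : Mᵀ = M) (c : ℝ) (u v : Fin a → ℝ) :
    (c • u + v) ⬝ᵥ M *ᵥ (c • u + v) =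
      c ^ 2 * (u ⬝ᵥ M *ᵥ u) + 2 * c * (u ⬝ᵥ M *ᵥ v) + v ⬝ᵥ M *ᵥ v := by
  rw [Matrix.mulVec_add, Matrix.mulVec_smul, add_dotProduct, dotProduct_add, dotProduct_add,
    smul_dotProduct, smul_dotProduct, dotProduct_smul, dotProduct_smul, quad_symm hM v u]
  simp only [smul_eq_mul]
  ring

/-- Weighted AM-GM for a positive semidefinite form. -/
lemma psd_amgm {a : ℕ} {M : Matrix (Fin a) (Fin a) ℝ} (hM : PSD M) {c : ℝ} (hc : 0 < c)
    (u v : Fin a → ℝ) : |2 * (u ⬝ᵥ M *ᵥ v)| ≤ c⁻¹ * (u ⬝ᵥ M *ᵥ u) + c * (v ⬝ᵥ M *ᵥ v) := by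
  have h1 := hM.2 (c⁻¹ • u + v)
  have h2 := hM.2 ((-c⁻¹) • u + v)
  rw [quad_expand hM.1] at h1 h2
  have h1' := mul_nonneg hc.le h1
  have h2' := mul_nonneg hc.le h2
  have e1 : c * (c⁻¹ ^ 2 * (u ⬝ᵥ M *ᵥ u) + 2 * c⁻¹ * (u ⬝ᵥ M *ᵥ v) + v ⬝ᵥ M *ᵥ v) =
      c⁻¹ * (u ⬝ᵥ M *ᵥ u) + 2 * (u ⬝ᵥ M *ᵥ v) + c * (v ⬝ᵥ M *ᵥ v) := by field_simp
  have e2 : c * ((-c⁻¹) ^ 2 * (u ⬝ᵥ M *ᵥ u) + 2 * (-c⁻¹) * (u ⬝ᵥ M *ᵥ v) + v ⬝ᵥ M *ᵥ v) =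
      c⁻¹ * (u ⬝ᵥ M *ᵥ u) - 2 * (u ⬝ᵥ M *ᵥ v) + c * (v ⬝ᵥ M *ᵥ v) := by field_simp; ring
  rw [e1] at h1'
  rw [e2] at h2'
  rw [abs_le]
  constructor <;> linarith

/-- Off-diagonal estimate for a bounded symmetric form. -/
lemma sym_bil {a : ℕ} {M : Matrix (Fin a) (Fin a) ℝ} (hM : Mᵀ = M) {m : ℝ}
    (h : ∀ x, |x ⬝ᵥ M *ᵥ x| ≤ m * (x ⬝ᵥ x)) {c : ℝ} (hc : 0 < c) (u v : Fin a → ℝ) :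
    -(2 * (u ⬝ᵥ M *ᵥ v)) ≤ m * (c * (u ⬝ᵥ u) + c⁻¹ * (v ⬝ᵥ v)) := by
  have h1 := (abs_le.1 (h (c • u + v))).1
  have h2 := (abs_le.1 (h ((-c) • u + v))).2
  rw [quad_expand hM] at h1 h2
  have e : ∀ c : ℝ, (c • u + v) ⬝ᵥ (c • u + v) =
      c ^ 2 * (u ⬝ᵥ u) + 2 * c * (u ⬝ᵥ v) + v ⬝ᵥ v := by
    intro c
    have := quad_expand (M := (1 : Matrix (Fin a) (Fin a) ℝ)) Matrix.transpose_one c u v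
    simpa only [Matrix.one_mulVec] using this
  rw [e] at h1 h2
  have h3 : -(4 * c * (u ⬝ᵥ M *ᵥ v)) ≤ 2 * m * (c ^ 2 * (u ⬝ᵥ u) + v ⬝ᵥ v) := by linarith
  have h4 := mul_le_mul_of_nonneg_left h3 (inv_pos.2 hc).le
  have e1 : c⁻¹ * (-(4 * c * (u ⬝ᵥ M *ᵥ v))) = -(4 * (u ⬝ᵥ M *ᵥ v)) := by field_simp
  have e2 : c⁻¹ * (2 * m * (c ^ 2 * (u ⬝ᵥ u) + v ⬝ᵥ v)) =
    2 * (m * (c * (u ⬝ᵥ u) + c⁻¹ * (v ⬝ᵥ v))) := by field_simp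
  rw [e1, e2] at h4
  linarith

lemma opE_quad_le (H : Hyp Pr Q R piv Sg) {P : Fin N → Matrix (Fin d) (Fin d) ℝ} {m : ℝ}
    (h : ∀ i x, x ⬝ᵥ P i *ᵥ x ≤ m * (x ⬝ᵥ x)) (i : Fin N) (x : Fin d → ℝ) :
    x ⬝ᵥ opE Pr P i *ᵥ x ≤ m * (x ⬝ᵥ x) := by
  unfold opE
  rw [Matrix.sum_mulVec, dotProduct_sum]
  calc ∑ j, x ⬝ᵥ (Pr i j • P j) *ᵥ x ≤ ∑ j, Pr i j * (m * (x ⬝ᵥ x)) := by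
        refine Finset.sum_le_sum fun j _ => ?_
        rw [Matrix.smul_mulVec, dotProduct_smul, smul_eq_mul]
        exact mul_le_mul_of_nonneg_left (h j x) (H.hPr i j)
    _ = _ := by rw [← Finset.sum_mul, H.hPrSum, one_mul]

lemma E_bound {a b : ℕ} (E : Fin N → Matrix (Fin a) (Fin b) ℝ) (i : Fin N) (x : Fin b → ℝ) :
    (E i *ᵥ x) ⬝ᵥ (E i *ᵥ x) ≤ norm2sq E * (x ⬝ᵥ x) := by
  rw [← quad_mul]
  refine (quad_le_trace (psd_gram (E i)) x).trans (mul_le_mul_of_nonneg_right ?_ (dot_self_nonneg x))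
  exact Finset.single_le_sum (f := fun i => ((E i)ᵀ * E i).trace)
    (fun j _ => psd_trace_nonneg (psd_gram (E j))) (Finset.mem_univ i)

lemma BE_bound (B : Fin N → Matrix (Fin d) (Fin k) ℝ) (E : Fin N → Matrix (Fin k) (Fin d) ℝ)
    (i : Fin N) (x : Fin d → ℝ) :
    ((B i * E i) *ᵥ x) ⬝ᵥ ((B i * E i) *ᵥ x) ≤ maxNorm B ^ 2 * ((E i *ᵥ x) ⬝ᵥ (E i *ᵥ x)) := by
  rw [← Matrix.mulVec_mulVec]
  exact maxNorm_bound B i _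

lemma GoodSpec.a_ge (H : Hyp Pr Q R piv Sg) {β : ℝ} {K : Fin N → Matrix (Fin k) (Fin d) ℝ}
    (hg : GoodSpec Pr A B Q R piv Sg β K) : lamMin Q ≤ β / mu piv Sg :=
  lam_le H hg.psd hg.lyap hg.pairle

lemma xi_mul (H : Hyp Pr Q R piv Sg) (β : ℝ) : lamMin Q * (xi B R Q piv Sg β + 1) =
    (1 + maxNorm B ^ 2) * (β / mu piv Sg) + maxNorm R := by
  have := H.lamQ
  unfold xi
  field_simp
  ring

lemma xi_nonneg (H : Hyp Pr Q R piv Sg) {β : ℝ} (hβ : lamMin Q ≤ β / mu piv Sg) :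
    0 ≤ xi B R Q piv Sg β := by
  have h1 := xi_mul (B := B) H β
  have h2 := H.lamQ
  have h3 := maxNorm_nonneg R
  have h4 : 0 ≤ maxNorm B ^ 2 * (β / mu piv Sg) := mul_nonneg (sq_nonneg _) (h2.le.trans hβ)
  have h5 : 0 ≤ lamMin Q * xi B R Q piv Sg β := by linarith
  exact nonneg_of_mul_nonneg_right h5 h2

lemma S1_abs (H : Hyp Pr Q R piv Sg) {β : ℝ} {K : Fin N → Matrix (Fin k) (Fin d) ℝ}
    (hg : GoodSpec Pr A B Q R piv Sg β K) (E : Fin N → Matrix (Fin k) (Fin d) ℝ) {e : ℝ}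
    (he : 0 < e) (hee : norm2sq E = e ^ 2) (i : Fin N) (x : Fin d → ℝ) :
    |x ⬝ᵥ S1 Pr A B R K (PK Pr A B Q R K) E i *ᵥ x| ≤
      e * xi B R Q piv Sg β * (x ⬝ᵥ srcS Q R K i *ᵥ x) := by
  set P := PK Pr A B Q R K with hP
  have hPE := psd_opE H.hPr hg.psd i
  rw [← hP] at hPE
  have hq : x ⬝ᵥ S1 Pr A B R K P E i *ᵥ x = 2 * ((E i *ᵥ x) ⬝ᵥ R i *ᵥ (K i *ᵥ x))
      - 2 * (((B i * E i) *ᵥ x) ⬝ᵥ opE Pr P i *ᵥ (Gam A B K i *ᵥ x)) := by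
    simp only [S1, Matrix.add_mulVec, Matrix.sub_mulVec, dotProduct_add, dotProduct_sub, quad_conj]
    rw [quad_symm (H.psdR i).1 (K i *ᵥ x), quad_symm hPE.1 (Gam A B K i *ᵥ x)]
    ring
  have h1 := psd_amgm (H.psdR i) he (E i *ᵥ x) (K i *ᵥ x)
  have h2 := psd_amgm hPE he ((B i * E i) *ᵥ x) (Gam A B K i *ᵥ x)
  have hE := E_bound E i x
  have hBE := BE_bound B E i x
  have h3 := maxNorm_quad R i (E i *ᵥ x)
  have h4 := opE_quad_le H (lyap_upper H hg.psd hg.pairle) i ((B i * E i) *ᵥ x)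
  have h5 : x ⬝ᵥ P i *ᵥ x = x ⬝ᵥ Q i *ᵥ x + (K i *ᵥ x) ⬝ᵥ R i *ᵥ (K i *ᵥ x)
      + (Gam A B K i *ᵥ x) ⬝ᵥ opE Pr P i *ᵥ (Gam A B K i *ᵥ x) := by
    have hl : P i = Q i + (K i)ᵀ * R i * K i + (Gam A B K i)ᵀ * opE Pr P i * Gam A B K i := hg.lyap i
    conv_lhs => rw [hl]
    rw [Matrix.add_mulVec, Matrix.add_mulVec, dotProduct_add, dotProduct_add, quad_conj, quad_conj]
  have h6 := lyap_upper H hg.psd hg.pairle i x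
  rw [← hP] at h4 h6
  have h7 := lamMin_quad H.hQ i x
  have hxi := xi_nonneg (B := B) H (hg.a_ge H)
  have hxm := xi_mul (B := B) H β
  have ha : 0 ≤ β / mu piv Sg := H.lamQ.le.trans (hg.a_ge H)
  have hr := maxNorm_nonneg R
  set a := β / mu piv Sg
  set r := maxNorm R
  set b := maxNorm B
  set ξ := xi B R Q piv Sg β
  rw [hee] at hE
  have h8 : e⁻¹ * ((E i *ᵥ x) ⬝ᵥ R i *ᵥ (E i *ᵥ x)) ≤ e * (r * (x ⬝ᵥ x)) := by
    rw [inv_mul_le_iff₀ he]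
    calc _ ≤ r * ((E i *ᵥ x) ⬝ᵥ (E i *ᵥ x)) := h3
      _ ≤ r * (e ^ 2 * (x ⬝ᵥ x)) := mul_le_mul_of_nonneg_left hE hr
      _ = _ := by ring
  have h9 : e⁻¹ * (((B i * E i) *ᵥ x) ⬝ᵥ opE Pr P i *ᵥ ((B i * E i) *ᵥ x)) ≤
      e * (b ^ 2 * a * (x ⬝ᵥ x)) := by
    rw [inv_mul_le_iff₀ he]
    calc _ ≤ a * (((B i * E i) *ᵥ x) ⬝ᵥ ((B i * E i) *ᵥ x)) := h4
      _ ≤ a * (b ^ 2 * ((E i *ᵥ x) ⬝ᵥ (E i *ᵥ x))) := mul_le_mul_of_nonneg_left hBE ha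
      _ ≤ a * (b ^ 2 * (e ^ 2 * (x ⬝ᵥ x))) := by gcongr
      _ = _ := by ring
  have h10 : x ⬝ᵥ srcS Q R K i *ᵥ x = x ⬝ᵥ Q i *ᵥ x + (K i *ᵥ x) ⬝ᵥ R i *ᵥ (K i *ᵥ x) := by
    unfold srcS
    rw [Matrix.add_mulVec, dotProduct_add, quad_conj]
  have h11 := (H.psdR i).2 (K i *ᵥ x)
  have h12 : |x ⬝ᵥ S1 Pr A B R K P E i *ᵥ x| ≤ e * ((r + b ^ 2 * a) * (x ⬝ᵥ x) +
      x ⬝ᵥ P i *ᵥ x - x ⬝ᵥ Q i *ᵥ x) := by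
    rw [hq]
    refine (abs_sub _ _).trans ?_
    rw [h5]
    linarith
  refine h12.trans ?_
  rw [h10, mul_assoc]
  refine mul_le_mul_of_nonneg_left ?_ he.le
  have h13 : (r + b ^ 2 * a) * (x ⬝ᵥ x) + a * (x ⬝ᵥ x) = (ξ + 1) * (lamMin Q * (x ⬝ᵥ x)) := by
    linear_combination (-(x ⬝ᵥ x)) * hxm
  have h14 : (ξ + 1) * (lamMin Q * (x ⬝ᵥ x)) ≤ (ξ + 1) * (x ⬝ᵥ Q i *ᵥ x) :=
    mul_le_mul_of_nonneg_left h7 (by linarith)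
  have h15 := mul_nonneg hxi h11
  linarith

lemma S1_symm (H : Hyp Pr Q R piv Sg) {K : Fin N → Matrix (Fin k) (Fin d) ℝ}
    {P : Fin N → Matrix (Fin d) (Fin d) ℝ} (hP : ∀ i, PSD (P i))
    (E : Fin N → Matrix (Fin k) (Fin d) ℝ) (i : Fin N) :
    (S1 Pr A B R K P E i)ᵀ = S1 Pr A B R K P E i := by
  rw [S1_eq H hP]
  simp only [transpose_add, transpose_mul, transpose_transpose]
  abel

lemma p1_W (H : Hyp Pr Q R piv Sg) {β : ℝ} {K : Fin N → Matrix (Fin k) (Fin d) ℝ}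
    (hg : GoodSpec Pr A B Q R piv Sg β K) (E : Fin N → Matrix (Fin k) (Fin d) ℝ) {e : ℝ}
    (he : 0 < e) (hee : norm2sq E = e ^ 2) {p : Fin N → Matrix (Fin d) (Fin d) ℝ}
    (hp : p = S1 Pr A B R K (PK Pr A B Q R K) E + Lop Pr (Gam A B K) p) {s : ℝ} (hs : |s| = 1)
    (i : Fin N) :
    PSD (((e * xi B R Q piv Sg β) • PK Pr A B Q R K + s • p) i) := by
  set c := e * xi B R Q piv Sg β with hc
  have hl := (isLyap_iff _ _ _ _ _ _ _).1 hg.lyap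
  have hW : c • PK Pr A B Q R K + s • p =
      (c • srcS Q R K + s • S1 Pr A B R K (PK Pr A B Q R K) E) +
        Lop Pr (Gam A B K) (c • PK Pr A B Q R K + s • p) := by
    rw [map_add, map_smul, map_smul]
    conv_lhs => rw [hl, hp]
    rw [smul_add, smul_add]
    abel
  refine hg.stab.psd (psd_Lop H.hPr _) hW (fun j => ⟨?_, fun x => ?_⟩) i
  · rw [Pi.add_apply, Pi.smul_apply, Pi.smul_apply, transpose_add, transpose_smul, transpose_smul,
      S1_symm H hg.psd, (H.psd_src K j).1]
  · rw [Pi.add_apply, Pi.smul_apply, Pi.smul_apply, Matrix.add_mulVec, Matrix.smul_mulVec,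
      Matrix.smul_mulVec, dotProduct_add, dotProduct_smul, dotProduct_smul, smul_eq_mul, smul_eq_mul]
    have h1 := S1_abs H hg E he hee j x
    have h2 : |s * (x ⬝ᵥ S1 Pr A B R K (PK Pr A B Q R K) E j *ᵥ x)| ≤ c * (x ⬝ᵥ srcS Q R K j *ᵥ x) := by
      rw [abs_mul, hs, one_mul]; exact h1
    have := (abs_le.1 h2).1
    linarith

lemma p1_bound (H : Hyp Pr Q R piv Sg) {β : ℝ} {K : Fin N → Matrix (Fin k) (Fin d) ℝ}
    (hg : GoodSpec Pr A B Q R piv Sg β K) (E : Fin N → Matrix (Fin k) (Fin d) ℝ) {e : ℝ}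
    (he : 0 < e) (hee : norm2sq E = e ^ 2) {p : Fin N → Matrix (Fin d) (Fin d) ℝ}
    (hp : p = S1 Pr A B R K (PK Pr A B Q R K) E + Lop Pr (Gam A B K) p) (i : Fin N) :
    (opE Pr p i)ᵀ = opE Pr p i ∧ ∀ x, |x ⬝ᵥ opE Pr p i *ᵥ x| ≤
      e * xi B R Q piv Sg β * (β / mu piv Sg) * (x ⬝ᵥ x) := by
  have hc : 0 ≤ e * xi B R Q piv Sg β := mul_nonneg he.le (xi_nonneg H (hg.a_ge H))
  have hW := fun (s : ℝ) (hs : |s| = 1) => p1_W H hg E he hee hp hs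
  set c := e * xi B R Q piv Sg β
  have hsym : ∀ j, (p j)ᵀ = p j := by
    intro j
    have h1 := (hW 1 (by norm_num) j).1
    rw [Pi.add_apply, Pi.smul_apply, Pi.smul_apply, one_smul, transpose_add, transpose_smul,
      (hg.psd j).1] at h1
    exact add_left_cancel h1
  have hb : ∀ (s : ℝ), |s| = 1 → ∀ j x, x ⬝ᵥ (s • p) j *ᵥ x ≤ c * (β / mu piv Sg) * (x ⬝ᵥ x) := by
    intro s hs j x
    have h1 := (hW (-s) (by rwa [abs_neg]) j).2 x
    rw [Pi.add_apply, Pi.smul_apply, Pi.smul_apply, Matrix.add_mulVec, Matrix.smul_mulVec,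
      Matrix.smul_mulVec, dotProduct_add, dotProduct_smul, dotProduct_smul, smul_eq_mul, smul_eq_mul] at h1
    rw [Pi.smul_apply, Matrix.smul_mulVec, dotProduct_smul, smul_eq_mul]
    have h2 := mul_le_mul_of_nonneg_left (lyap_upper H hg.psd hg.pairle j x) hc
    linarith
  refine ⟨?_, fun x => ?_⟩
  · unfold opE
    rw [transpose_sum]
    refine Finset.sum_congr rfl fun j _ => ?_
    rw [transpose_smul, hsym]
  · have h1 := opE_quad_le H (hb 1 (by norm_num)) i x
    have h2 := opE_quad_le H (hb (-1) (by norm_num)) i x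
    have e1 : opE Pr ((1 : ℝ) • p) i = opE Pr p i := by rw [one_smul]
    have e2 : opE Pr ((-1 : ℝ) • p) i = -opE Pr p i := by
      unfold opE
      rw [← Finset.sum_neg_distrib]
      refine Finset.sum_congr rfl fun j _ => ?_
      rw [Pi.smul_apply, neg_one_smul, smul_neg]
    rw [e1] at h1
    rw [e2, Matrix.neg_mulVec, dotProduct_neg] at h2
    rw [abs_le]
    constructor <;> linarith

lemma Lsm_eq (β : ℝ) : Lsm B R Q piv Sg β = (2 * (maxNorm R + maxNorm B ^ 2 * (β / mu piv Sg)) +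
    4 * (maxNorm B * xi B R Q piv Sg β * (β / mu piv Sg))) * (β / lamMin Q) := by
  unfold Lsm
  rcases eq_or_ne (maxNorm B) 0 with h | h
  · rw [h]; ring
  · have : maxNorm B ^ 2 * (1 + 2 * xi B R Q piv Sg β / maxNorm B) =
      maxNorm B ^ 2 + 2 * maxNorm B * xi B R Q piv Sg β := by field_simp
    rw [this]; ring

lemma hess_bound (H : Hyp Pr Q R piv Sg) {β : ℝ} {K : Fin N → Matrix (Fin k) (Fin d) ℝ}
    (hg : GoodSpec Pr A B Q R piv Sg β K) (E : Fin N → Matrix (Fin k) (Fin d) ℝ) {e : ℝ}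
    (he : 0 < e) (hee : norm2sq E = e ^ 2) {p X : Fin N → Matrix (Fin d) (Fin d) ℝ}
    (hp : p = S1 Pr A B R K (PK Pr A B Q R K) E + Lop Pr (Gam A B K) p)
    (hX : X = X0 piv Sg + Top Pr (Gam A B K) X) (hXp : ∀ i, PSD (X i)) :
    pair X (S2 Pr A B R K (PK Pr A B Q R K) p E) ≤ Lsm B R Q piv Sg β * e ^ 2 := by
  have hxi := xi_nonneg (B := B) H (hg.a_ge H)
  have ha : 0 ≤ β / mu piv Sg := H.lamQ.le.trans (hg.a_ge H)
  have hr := maxNorm_nonneg R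
  have hb := maxNorm_nonneg B
  have hup := lyap_upper H hg.psd hg.pairle
  have hpb := p1_bound H hg E he hee hp
  have htr := X_trace H hg hX hXp
  have htr2 := (X_Gam_trace H hX).trans htr
  rw [Lsm_eq]
  set a := β / mu piv Sg
  set r := maxNorm R
  set b := maxNorm B with hbdef
  set ξ := xi B R Q piv Sg β
  set P := PK Pr A B Q R K with hP
  have hq : ∀ i x, x ⬝ᵥ S2 Pr A B R K P p E i *ᵥ x ≤
      (2 * (r + b ^ 2 * a) + 2 * (b * ξ * a)) * ((E i *ᵥ x) ⬝ᵥ (E i *ᵥ x)) +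
      2 * (b * ξ * a) * e ^ 2 * ((Gam A B K i *ᵥ x) ⬝ᵥ (Gam A B K i *ᵥ x)) := by
    intro i x
    obtain ⟨hs, hm⟩ := hpb i
    have e1 : x ⬝ᵥ S2 Pr A B R K P p E i *ᵥ x = 2 * ((E i *ᵥ x) ⬝ᵥ R i *ᵥ (E i *ᵥ x)) +
        2 * (((B i * E i) *ᵥ x) ⬝ᵥ opE Pr P i *ᵥ ((B i * E i) *ᵥ x)) +
        2 * (-(2 * (((B i * E i) *ᵥ x) ⬝ᵥ opE Pr p i *ᵥ (Gam A B K i *ᵥ x)))) := by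
      simp only [S2, Matrix.smul_mulVec, Matrix.add_mulVec, Matrix.sub_mulVec, dotProduct_add,
        dotProduct_sub, dotProduct_smul, quad_conj, smul_eq_mul]
      rw [quad_symm hs (Gam A B K i *ᵥ x)]
      ring
    have h3 := maxNorm_quad R i (E i *ᵥ x)
    have hBE := BE_bound B E i x
    have h4 : ((B i * E i) *ᵥ x) ⬝ᵥ opE Pr P i *ᵥ ((B i * E i) *ᵥ x) ≤
        b ^ 2 * a * ((E i *ᵥ x) ⬝ᵥ (E i *ᵥ x)) := by
      calc _ ≤ a * (((B i * E i) *ᵥ x) ⬝ᵥ ((B i * E i) *ᵥ x)) := opE_quad_le H hup i _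
        _ ≤ a * (b ^ 2 * ((E i *ᵥ x) ⬝ᵥ (E i *ᵥ x))) := mul_le_mul_of_nonneg_left hBE ha
        _ = _ := by ring
    have h5 : -(2 * (((B i * E i) *ᵥ x) ⬝ᵥ opE Pr p i *ᵥ (Gam A B K i *ᵥ x))) ≤
        (b * ξ * a) * ((E i *ᵥ x) ⬝ᵥ (E i *ᵥ x)) +
        (b * ξ * a) * e ^ 2 * ((Gam A B K i *ᵥ x) ⬝ᵥ (Gam A B K i *ᵥ x)) := by
      rcases hb.eq_or_lt with hb0 | hb0
      · have hz : (B i * E i) *ᵥ x = 0 := by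
          rw [← dotProduct_self_eq_zero]
          refine le_antisymm ?_ (dot_self_nonneg _)
          rw [← hbdef, ← hb0] at hBE
          simpa using hBE
        rw [hz, ← hb0]
        simp
      · have h6 := sym_bil hs hm (c := (e * b)⁻¹) (by positivity) ((B i * E i) *ᵥ x) (Gam A B K i *ᵥ x)
        refine h6.trans ?_
        calc e * ξ * a * ((e * b)⁻¹ * (((B i * E i) *ᵥ x) ⬝ᵥ ((B i * E i) *ᵥ x)) +
              (e * b)⁻¹⁻¹ * ((Gam A B K i *ᵥ x) ⬝ᵥ (Gam A B K i *ᵥ x)))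
            ≤ e * ξ * a * ((e * b)⁻¹ * (b ^ 2 * ((E i *ᵥ x) ⬝ᵥ (E i *ᵥ x))) +
              (e * b)⁻¹⁻¹ * ((Gam A B K i *ᵥ x) ⬝ᵥ (Gam A B K i *ᵥ x))) := by gcongr
          _ = _ := by field_simp
    rw [e1]
    linarith
  have h1 : pair X (S2 Pr A B R K P p E) ≤ pair X
      ((2 * (r + b ^ 2 * a) + 2 * (b * ξ * a)) • (fun i => (E i)ᵀ * E i) +
      (2 * (b * ξ * a) * e ^ 2) • (fun i => (Gam A B K i)ᵀ * Gam A B K i)) := by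
    refine pair_mono hXp fun i x => ?_
    rw [Pi.add_apply, Pi.smul_apply, Pi.smul_apply, Matrix.add_mulVec, Matrix.smul_mulVec,
      Matrix.smul_mulVec, dotProduct_add, dotProduct_smul, dotProduct_smul, smul_eq_mul, smul_eq_mul,
      quad_mul, quad_mul]
    exact hq i x
  have hXup : ∀ i x, x ⬝ᵥ X i *ᵥ x ≤ (β / lamMin Q) * (x ⬝ᵥ x) := by
    intro i x
    refine (quad_le_trace (hXp i) x).trans (mul_le_mul_of_nonneg_right ?_ (dot_self_nonneg x))
    refine le_trans ?_ htr
    exact Finset.single_le_sum (f := fun i => (X i).trace)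
      (fun j _ => psd_trace_nonneg (hXp j)) (Finset.mem_univ i)
  have h2 := pair_gram_le hXup E
  rw [hee] at h2
  have h3 : pair X (fun i => (Gam A B K i)ᵀ * Gam A B K i) ≤ β / lamMin Q := by
    refine le_trans (le_of_eq ?_) htr2
    unfold pair
    refine Finset.sum_congr rfl fun i _ => ?_
    rw [← Matrix.mul_assoc, Matrix.trace_mul_comm, ← Matrix.mul_assoc]
  rw [pair_add_right, pair_smul_right, pair_smul_right] at h1
  have hc1 : 0 ≤ 2 * (r + b ^ 2 * a) + 2 * (b * ξ * a) := by positivity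
  have hc2 : 0 ≤ 2 * (b * ξ * a) * e ^ 2 := by positivity
  have h4 := mul_le_mul_of_nonneg_left h2 hc1
  have h5 := mul_le_mul_of_nonneg_left h3 hc2
  linarith
end hess

section openclosed
variable {d k N : ℕ} {Pr : Matrix (Fin N) (Fin N) ℝ}
    {A : Fin N → Matrix (Fin d) (Fin d) ℝ} {B : Fin N → Matrix (Fin d) (Fin k) ℝ}
    {Q : Fin N → Matrix (Fin d) (Fin d) ℝ} {R : Fin N → Matrix (Fin k) (Fin k) ℝ}
    {piv : Fin N → ℝ} {Sg : Matrix (Fin d) (Fin d) ℝ}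

lemma descent_real {f f1 f2 : ℝ → ℝ} {T C : ℝ}
    (h1 : ∀ t ∈ Set.Icc 0 T, HasDerivAt f (f1 t) t) (h2 : ∀ t ∈ Set.Icc 0 T, HasDerivAt f1 (f2 t) t)
    (h3 : ∀ t ∈ Set.Icc 0 T, f2 t ≤ C) {t : ℝ} (ht : t ∈ Set.Icc 0 T) :
    f t ≤ f 0 + f1 0 * t + C * t ^ 2 / 2 := by
  have h0 : (0 : ℝ) ∈ Set.Icc 0 T := ⟨le_rfl, ht.1.trans ht.2⟩
  have hg : ∀ t ∈ Set.Icc 0 T, HasDerivAt (fun s => C * s - f1 s) (C * 1 - f2 t) t := fun t ht =>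
    ((hasDerivAt_id t).const_mul C).sub (h2 t ht)
  have mg : MonotoneOn (fun s => C * s - f1 s) (Set.Icc 0 T) := by
    refine monotoneOn_of_deriv_nonneg (convex_Icc 0 T)
      (fun t ht => (hg t ht).continuousAt.continuousWithinAt)
      (fun t ht => (hg t (interior_subset ht)).differentiableAt.differentiableWithinAt) ?_
    intro t ht
    rw [(hg t (interior_subset ht)).deriv]
    have := h3 t (interior_subset ht)
    linarith
  have hh : ∀ t ∈ Set.Icc 0 T, HasDerivAt (fun s => f1 0 * s + C / 2 * (s ^ 2) - f s)
      (f1 0 * 1 + C / 2 * (((2 : ℕ) : ℝ) * t ^ (2 - 1)) - f1 t) t := fun t ht =>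
    (((hasDerivAt_id t).const_mul (f1 0)).add ((hasDerivAt_pow 2 t).const_mul (C / 2))).sub (h1 t ht)
  have mh : MonotoneOn (fun s => f1 0 * s + C / 2 * (s ^ 2) - f s) (Set.Icc 0 T) := by
    refine monotoneOn_of_deriv_nonneg (convex_Icc 0 T)
      (fun t ht => (hh t ht).continuousAt.continuousWithinAt)
      (fun t ht => (hh t (interior_subset ht)).differentiableAt.differentiableWithinAt) ?_
    intro t ht
    rw [(hh t (interior_subset ht)).deriv]
    have h4 := mg h0 (interior_subset ht) (interior_subset ht).1
    norm_num at h4 ⊢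
    linarith
  have h5 := mh h0 ht ht.1
  norm_num at h5
  linarith

lemma descent (H : Hyp Pr Q R piv Sg) {β : ℝ} {K : Fin N → Matrix (Fin k) (Fin d) ℝ}
    (E : Fin N → Matrix (Fin k) (Fin d) ℝ) {e : ℝ}
    (he : 0 < e) (hee : norm2sq E = e ^ 2) {T D : ℝ}
    (hg : ∀ s ∈ Set.Icc 0 T, GoodSpec Pr A B Q R piv Sg β (K + s • E))
    (hD : HasDerivAt (fun s : ℝ => cost Pr A B Q R piv Sg (K + s • E)) D 0)
    {t : ℝ} (ht : t ∈ Set.Icc 0 T) :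
    cost Pr A B Q R piv Sg (K + t • E) ≤ cost Pr A B Q R piv Sg K + D * t
      + Lsm B R Q piv Sg β * e ^ 2 * t ^ 2 / 2 := by
  have h0 : (0 : ℝ) ∈ Set.Icc 0 T := ⟨le_rfl, ht.1.trans ht.2⟩
  have hDe := hD.unique (deriv_cost_line (hg 0 h0).unit)
  have h := descent_real (f := fun s => cost Pr A B Q R piv Sg (K + s • E))
    (f1 := fun s => pair (X0 piv Sg) (deriv (fun s : ℝ => PK Pr A B Q R (K + s • E)) s))
    (f2 := fun s => pair (X0 piv Sg) (deriv (deriv (fun s : ℝ => PK Pr A B Q R (K + s • E))) s))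
    (C := Lsm B R Q piv Sg β * e ^ 2)
    (fun s hs => deriv_cost_line (hg s hs).unit)
    (fun s hs => pair_hasDerivAt _ (deriv2_line (hg s hs).unit))
    (fun s hs => by
      obtain ⟨X, hX, hXp⟩ := exists_X H (hg s hs).stab
      rw [pair_sol hX (deriv2_eq (hg s hs).unit)]
      exact hess_bound H (hg s hs) E he hee (deriv1_eq (hg s hs).unit) hX hXp) ht
  simp only [zero_smul, add_zero] at h
  rw [← hDe] at h
  exact h

lemma PK_symm (H : Hyp Pr Q R piv Sg) {K : Fin N → Matrix (Fin k) (Fin d) ℝ}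
    (hu : IsUnit (1 - Lc Pr A B K)) (i : Fin N) : (PK Pr A B Q R K i)ᵀ = PK Pr A B Q R K i := by
  have h1 : IsLyap Pr A B Q R K (fun i => (PK Pr A B Q R K i)ᵀ) := by
    intro i
    have h2 : opE Pr (fun i => (PK Pr A B Q R K i)ᵀ) i = (opE Pr (PK Pr A B Q R K) i)ᵀ := by
      unfold opE
      rw [transpose_sum]
      rfl
    rw [h2]
    have h3 := congrArg Matrix.transpose (isLyap_of_unit (Q := Q) (R := R) hu i)
    refine h3.trans ?_
    simp only [transpose_add, transpose_mul, transpose_transpose, (H.psdQ i).1, (H.psdR i).1,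
      Matrix.mul_assoc]
  exact (congrFun (PK_unique hu h1) i).symm

lemma good_open (H : Hyp Pr Q R piv Sg) {α β : ℝ} (hαβ : α < β)
    {K : Fin N → Matrix (Fin k) (Fin d) ℝ} (hg : GoodSpec Pr A B Q R piv Sg α K) :
    ∀ᶠ K' in 𝓝 K, Good Pr A B Q R piv Sg β K' := by
  have hc : ContinuousAt (PK Pr A B Q R) K := (PK_contDiffAt hg.unit).continuousAt
  have h1 : ∀ᶠ K' in 𝓝 K, pair (X0 piv Sg) (PK Pr A B Q R K') < β := by
    have : ContinuousAt (fun K' => pair (X0 piv Sg) (PK Pr A B Q R K')) K :=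
      (pair_tendsto_right (X0 piv Sg)).continuousAt.comp hc
    exact this.eventually_lt continuousAt_const (hg.pairle.trans_lt hαβ)
  have h2 : ∀ᶠ K' in 𝓝 K, ∀ i, ∑ a, ∑ b, |(PK Pr A B Q R K' i - PK Pr A B Q R K i) a b| < lamMin Q := by
    rw [eventually_all]
    intro i
    have h3 : ∀ a b, ContinuousAt (fun K' => PK Pr A B Q R K' i a b) K := fun a b =>
      continuousAt_pi.1 (continuousAt_pi.1 (continuousAt_pi.1 hc i) a) b
    have h4 : ContinuousAt (fun K' => ∑ a, ∑ b, |(PK Pr A B Q R K' i - PK Pr A B Q R K i) a b|) K := by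
      refine tendsto_finsetSum _ fun a _ => tendsto_finsetSum _ fun b _ => ?_
      exact ((h3 a b).sub continuousAt_const).abs
    refine h4.eventually_lt continuousAt_const ?_
    simpa using H.lamQ
  filter_upwards [h1, h2, eventually_unit hg.unit] with K' h1 h2 hu
  refine ⟨_, fun i => ⟨PK_symm H hu i, fun x => ?_⟩, isLyap_of_unit hu, h1.le⟩
  have h5 := bil_bound (PK Pr A B Q R K' i - PK Pr A B Q R K i) x x
  have h6 := lyap_lower H hg.psd hg.lyap i x
  have h7 := dot_self_nonneg x
  rw [Matrix.sub_mulVec, dotProduct_sub] at h5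
  have h8 := (abs_le.1 h5).1
  have h9 := mul_le_mul_of_nonneg_right (h2 i).le h7
  have e1 : (x ⬝ᵥ x + x ⬝ᵥ x) / 2 = x ⬝ᵥ x := by ring
  rw [e1] at h8
  linarith

lemma entry_bound {a : ℕ} {M : Matrix (Fin a) (Fin a) ℝ} (hM : PSD M) {m : ℝ}
    (h : ∀ x, x ⬝ᵥ M *ᵥ x ≤ m * (x ⬝ᵥ x)) (p q : Fin a) : M p q ∈ Set.Icc (-m) m := by
  have h1 : ∀ x, |x ⬝ᵥ M *ᵥ x| ≤ m * (x ⬝ᵥ x) := fun x => by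
    rw [abs_of_nonneg (hM.2 x)]; exact h x
  have h2 := sym_bil hM.1 h1 one_pos (Pi.single p 1) (Pi.single q 1)
  have h3 := sym_bil hM.1 h1 one_pos (-Pi.single p 1) (Pi.single q 1)
  simp at h2 h3
  constructor <;> linarith

lemma good_closed (H : Hyp Pr Q R piv Sg) (α : ℝ) (K E : Fin N → Matrix (Fin k) (Fin d) ℝ) :
    IsClosed {t : ℝ | Good Pr A B Q R piv Sg α (K + t • E)} := by
  have hcpt : IsCompact (Set.univ.pi fun _ : Fin N => Set.univ.pi fun _ : Fin d => Set.univ.pi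
      fun _ : Fin d => Set.Icc (-(α / mu piv Sg)) (α / mu piv Sg)) :=
    isCompact_univ_pi fun _ => isCompact_univ_pi fun _ => isCompact_univ_pi fun _ => isCompact_Icc
  have hcl : IsClosed {z : ℝ × (Fin N → Matrix (Fin d) (Fin d) ℝ) | (∀ i, PSD (z.2 i)) ∧
      IsLyap Pr A B Q R (K + z.1 • E) z.2 ∧ pair (X0 piv Sg) z.2 ≤ α} := by
    have c2 : ∀ i, Continuous fun z : ℝ × (Fin N → Matrix (Fin d) (Fin d) ℝ) => z.2 i := fun i =>
      (continuous_apply i).comp continuous_snd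
    have cK : ∀ i, Continuous fun z : ℝ × (Fin N → Matrix (Fin d) (Fin d) ℝ) => (K + z.1 • E) i :=
      fun i => continuous_const.add (continuous_fst.smul continuous_const)
    have cG : ∀ i, Continuous fun z : ℝ × (Fin N → Matrix (Fin d) (Fin d) ℝ) =>
      Gam A B (K + z.1 • E) i := fun i =>
        continuous_const.sub (continuous_const.matrix_mul (cK i))
    have cE : ∀ i, Continuous fun z : ℝ × (Fin N → Matrix (Fin d) (Fin d) ℝ) => opE Pr z.2 i :=
      fun i => continuous_finsetSum _ fun j _ => (continuous_const (y := Pr i j)).smul (c2 j)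
    refine IsClosed.inter ?_ (IsClosed.inter ?_ ?_)
    · have : {z : ℝ × (Fin N → Matrix (Fin d) (Fin d) ℝ) | ∀ i, PSD (z.2 i)} =
        ⋂ i, (fun z : ℝ × (Fin N → Matrix (Fin d) (Fin d) ℝ) => z.2 i) ⁻¹' {M | PSD M} := by
        ext z; simp
      refine (congrArg IsClosed this).mpr ?_
      exact isClosed_iInter fun i => isClosed_psd.preimage (c2 i)
    · have : {z : ℝ × (Fin N → Matrix (Fin d) (Fin d) ℝ) | IsLyap Pr A B Q R (K + z.1 • E) z.2} =
        ⋂ i, {z | z.2 i = Q i + ((K + z.1 • E) i)ᵀ * R i * (K + z.1 • E) i +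
          (Gam A B (K + z.1 • E) i)ᵀ * opE Pr z.2 i * Gam A B (K + z.1 • E) i} := by
        ext z; simp [IsLyap]
      refine (congrArg IsClosed this).mpr ?_
      refine isClosed_iInter fun i => isClosed_eq (c2 i) ?_
      exact (continuous_const.add ((((cK i).matrix_transpose).matrix_mul continuous_const).matrix_mul
        (cK i))).add ((((cG i).matrix_transpose).matrix_mul (cE i)).matrix_mul (cG i))
    · exact isClosed_le ((pair_tendsto_right (X0 piv Sg)).comp continuous_snd) continuous_const
  refine IsSeqClosed.isClosed ?_
  intro u t hu hut
  choose P hP using hu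
  obtain ⟨P0, -, φ, hφ, hlim⟩ := hcpt.tendsto_subseq
    (x := (show ℕ → Fin N → Fin d → Fin d → ℝ from P)) (fun n i _ p _ q _ =>
    entry_bound ((hP n).1 i) (lyap_upper H (hP n).1 (hP n).2.2 i) p q)
  have h1 : Tendsto (fun n => (u (φ n), P (φ n))) atTop (𝓝 (t, P0)) :=
    (hut.comp hφ.tendsto_atTop).prodMk_nhds hlim
  have h2 := hcl.mem_of_tendsto h1 (Eventually.of_forall fun n => hP (φ n))
  exact ⟨P0, h2⟩
end openclosed

section final
variable {d k N : ℕ} {Pr : Matrix (Fin N) (Fin N) ℝ}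
    {A : Fin N → Matrix (Fin d) (Fin d) ℝ} {B : Fin N → Matrix (Fin d) (Fin k) ℝ}
    {Q : Fin N → Matrix (Fin d) (Fin d) ℝ} {R : Fin N → Matrix (Fin k) (Fin k) ℝ}
    {piv : Fin N → ℝ} {Sg : Matrix (Fin d) (Fin d) ℝ}

lemma Lsm_continuous : Continuous fun β : ℝ => Lsm B R Q piv Sg β := by
  have h : Continuous fun β : ℝ => xi B R Q piv Sg β := by
    unfold xi
    fun_prop
  unfold Lsm
  fun_prop

lemma quad_neg {c e s η : ℝ} (hs0 : 0 ≤ s) (hs : s ≤ η) (hc : c * η ≤ 2) :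
    -(e ^ 2) * s + c * e ^ 2 * s ^ 2 / 2 ≤ 0 := by
  have h1 : c * s ≤ 2 := by
    rcases le_total 0 c with h | h
    · exact (mul_le_mul_of_nonneg_left hs h).trans hc
    · nlinarith
  have h2 : 0 ≤ e ^ 2 * s := mul_nonneg (sq_nonneg e) hs0
  nlinarith

lemma stay_good (H : Hyp Pr Q R piv Sg) {α η : ℝ} {K E : Fin N → Matrix (Fin k) (Fin d) ℝ} {e : ℝ}
    (he : 0 < e) (hee : norm2sq E = e ^ 2) (hη0 : 0 < η) (hη : Lsm B R Q piv Sg α * η ≤ 1)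
    (hg : GoodSpec Pr A B Q R piv Sg α K)
    (hD : HasDerivAt (fun s : ℝ => cost Pr A B Q R piv Sg (K + s • E)) (-(e ^ 2)) 0) :
    ∀ s ∈ Set.Icc 0 η, GoodSpec Pr A B Q R piv Sg α (K + s • E) := by
  obtain ⟨β, hβ2, hβ⟩ : ∃ β, Lsm B R Q piv Sg β * η < 2 ∧ α < β := by
    have hc : ContinuousAt (fun β : ℝ => Lsm B R Q piv Sg β * η) α :=
      (Lsm_continuous.mul continuous_const).continuousAt
    have h1 : ∀ᶠ β in 𝓝 α, Lsm B R Q piv Sg β * η < 2 :=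
      hc.eventually_lt continuousAt_const (by linarith)
    have h2 : ∀ᶠ β in 𝓝[>] α, Lsm B R Q piv Sg β * η < 2 := h1.filter_mono nhdsWithin_le_nhds
    have h3 : ∀ᶠ β in 𝓝[>] α, α < β := self_mem_nhdsWithin
    exact (h2.and h3).exists
  have hcl := good_closed (A := A) (B := B) H α K E
  set Z : Set ℝ := {t | ∀ u ∈ Set.Icc 0 t, Good Pr A B Q R piv Sg α (K + u • E)} with hZ
  have hsub : Set.Icc 0 η ⊆ Z := by
    refine IsClosed.Icc_subset_of_forall_exists_gt ?_ ?_ ?_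
    · refine IsSeqClosed.isClosed ?_
      intro x t hx hxt
      have htI : t ∈ Set.Icc 0 η := isClosed_Icc.mem_of_tendsto hxt (Eventually.of_forall fun n => (hx n).2)
      refine ⟨?_, htI⟩
      intro u hu
      rcases hu.2.lt_or_eq with h | h
      · obtain ⟨n, hn⟩ := (hxt.eventually (lt_mem_nhds h)).exists
        exact (hx n).1 u ⟨hu.1, le_of_lt hn⟩
      · rw [h]
        exact hcl.mem_of_tendsto hxt (Eventually.of_forall fun n =>
          (hx n).1 (x n) ⟨(hx n).2.1, le_rfl⟩)
    · intro u hu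
      have : u = 0 := le_antisymm hu.2 hu.1
      rw [this, zero_smul, add_zero]
      exact hg.good
    · intro t ht y hy
      have hgt : GoodSpec Pr A B Q R piv Sg α (K + t • E) :=
        (ht.1 t ⟨ht.2.1, le_rfl⟩).spec H
      have hcont : ContinuousAt (fun s : ℝ => K + s • E) t :=
        (continuous_const.add (continuous_id.smul continuous_const)).continuousAt
      have hev : ∀ᶠ s in 𝓝 t, Good Pr A B Q R piv Sg β (K + s • E) :=
        hcont.eventually (good_open H hβ hgt)
      obtain ⟨ε, hε, hball⟩ := Metric.eventually_nhds_iff.1 hev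
      have hty : t < y := hy
      set z := min (min y η) (t + ε / 2) with hz
      have htz : t < z := lt_min (lt_min hty ht.2.2) (by linarith)
      have hzη : z ≤ η := (min_le_left _ _).trans (min_le_right _ _)
      have hzy : z ≤ y := (min_le_left _ _).trans (min_le_left _ _)
      have hzε : z ≤ t + ε / 2 := min_le_right _ _
      have hgβ : ∀ s ∈ Set.Icc 0 z, GoodSpec Pr A B Q R piv Sg β (K + s • E) := by
        intro s hs
        rcases le_or_gt s t with h | h
        · obtain ⟨P, h1, h2, h3⟩ := ht.1 s ⟨hs.1, h⟩
          exact Good.spec H ⟨P, h1, h2, h3.trans hβ.le⟩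
        · refine (hball ?_).spec H
          rw [Real.dist_eq, abs_of_pos (by linarith)]
          linarith [hs.2]
      refine ⟨z, ?_, htz, hzy⟩
      intro s hs
      have h1 := descent H E he hee hgβ hD hs
      have h2 := quad_neg (e := e) hs.1 (hs.2.trans hzη) hβ2.le
      have h3 := hgβ s hs
      refine ⟨_, h3.psd, h3.lyap, ?_⟩
      rw [← cost_eq]
      have h4 : cost Pr A B Q R piv Sg K ≤ α := by rw [cost_eq]; exact hg.pairle
      linarith
  intro s hs
  exact (hsub hs s ⟨hs.1, le_rfl⟩).spec H

lemma main_aux (H : Hyp Pr Q R piv Sg) {α η : ℝ} {K Ks G : Fin N → Matrix (Fin k) (Fin d) ℝ}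
    (hK : MSS Pr A B K) (hKα : cost Pr A B Q R piv Sg K ≤ α)
    (hG : ∀ E : Fin N → Matrix (Fin k) (Fin d) ℝ, fderiv ℝ (cost Pr A B Q R piv Sg) K E = ip G E)
    (hη0 : 0 < η) (hη : η ≤ 1 / Lsm B R Q piv Sg α) (hKs : MSS Pr A B Ks) :
    cost Pr A B Q R piv Sg (K - η • G) - cost Pr A B Q R piv Sg Ks
      ≤ (1 - 2 * mu piv Sg ^ 2 * lamMin R * η / maxNorm (XK Pr piv Sg (Gam A B Ks)))
          * (cost Pr A B Q R piv Sg K - cost Pr A B Q R piv Sg Ks) := by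
  have hg : GoodSpec Pr A B Q R piv Sg α K := by
    have h1 := good_of_stab (Q := Q) (R := R) H hK.stab
    exact Good.spec H ⟨_, h1.2, h1.1, by rw [← cost_eq]; exact hKα⟩
  have hLη : Lsm B R Q piv Sg α * η ≤ 1 := by
    have hpos : 0 < Lsm B R Q piv Sg α := one_div_pos.1 (hη0.trans_le hη)
    rw [le_div_iff₀ hpos] at hη
    linarith
  -- descent step
  have hdesc : cost Pr A B Q R piv Sg (K - η • G) ≤ cost Pr A B Q R piv Sg K - η / 2 * norm2sq G := by
    rcases (norm2sq_nonneg G).eq_or_lt with h0 | h0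
    · have hG0 : G = 0 := eq_zero_of_norm2sq h0.symm
      rw [← h0, hG0]
      simp
    · have hneg : norm2sq (-G) = norm2sq G := by
        unfold norm2sq
        simp
      have he : 0 < Real.sqrt (norm2sq G) := Real.sqrt_pos.2 h0
      have hee : norm2sq (-G) = Real.sqrt (norm2sq G) ^ 2 := by
        rw [hneg, Real.sq_sqrt h0.le]
      have hipn : ip G (-G) = -(Real.sqrt (norm2sq G) ^ 2) := by
        rw [Real.sq_sqrt h0.le]
        unfold ip norm2sq
        simp
      have hD : HasDerivAt (fun s : ℝ => cost Pr A B Q R piv Sg (K + s • (-G)))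
          (-(Real.sqrt (norm2sq G) ^ 2)) 0 := by
        have h1 := fderiv_line
          (cost_differentiableAt (Q := Q) (R := R) (piv := piv) (Sg := Sg) hg.unit) (-G)
        have h2 := (hG (-G)).trans hipn
        exact h2 ▸ h1
      have hst := stay_good H he hee hη0 hLη hg hD
      have h1 := descent H (-G) he hee hst hD (t := η) ⟨hη0.le, le_rfl⟩
      rw [Real.sq_sqrt h0.le] at h1
      have h2 : K - η • G = K + η • (-G) := by rw [smul_neg, sub_eq_add_neg]
      rw [h2]
      have h3 : Lsm B R Q piv Sg α * η * (norm2sq G * η) ≤ 1 * (norm2sq G * η) :=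
        mul_le_mul_of_nonneg_right hLη (mul_nonneg h0.le hη0.le)
      nlinarith
  -- gradient domination
  set X := XK Pr piv Sg (Gam A B Ks) with hXdef
  have hX : X = X0 piv Sg + Top Pr (Gam A B Ks) X := hKs.XK_eq piv Sg
  have hXp : ∀ i, PSD (X i) := hKs.stab.dual.psd (psd_Top H.hPr _) hX H.psdX0
  have hm : 0 < maxNorm X := by
    obtain ⟨x, hx⟩ := exists_ne H
    have h1 := X_ge H hX hXp ⟨0, H.hN⟩ x
    have h2 := maxNorm_quad X ⟨0, H.hN⟩ x
    rw [hx] at h1 h2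
    linarith [H.mu0]
  have hgs := good_of_stab (Q := Q) (R := R) H hKs.stab
  have h1 := grad_dom H hg.psd hg.lyap hgs.1 hX hXp
  rw [← cost_eq, ← cost_eq] at h1
  have h2 := grad_formula H hg hG
  have hmu := H.mu0
  have hr := H.lamR
  set M := maxNorm X
  set ρ := lamMin R
  set μ := mu piv Sg
  set n := norm2sq (Lmat Pr A B R K (PK Pr A B Q R K))
  have h3 : 2 * μ ^ 2 * ρ * η / M * (cost Pr A B Q R piv Sg K - cost Pr A B Q R piv Sg Ks) ≤
      2 * μ ^ 2 * ρ * η / M * (M / ρ * n) := mul_le_mul_of_nonneg_left h1 (by positivity)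
  have h4 : 2 * μ ^ 2 * ρ * η / M * (M / ρ * n) = η / 2 * (4 * μ ^ 2 * n) := by
    field_simp
    ring
  have h5 : η / 2 * (4 * μ ^ 2 * n) ≤ η / 2 * norm2sq G :=
    mul_le_mul_of_nonneg_left h2 (by positivity)
  linarith
end final

/-- one-step contraction of gradient descent. -/
theorem gd_one_step_contraction
    (d k N : ℕ) (hd : 0 < d) (hk : 0 < k) (hN : 0 < N)
    (A : Fin N → Matrix (Fin d) (Fin d) ℝ) (B : Fin N → Matrix (Fin d) (Fin k) ℝ)
    (Pr : Matrix (Fin N) (Fin N) ℝ)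
    (hPr : ∀ i j, 0 ≤ Pr i j) (hPrSum : ∀ i, ∑ j, Pr i j = 1)
    (piv : Fin N → ℝ) (hpiv : ∀ i, 0 < piv i) (hpivSum : ∑ i, piv i = 1)
    (Sg : Matrix (Fin d) (Fin d) ℝ) (hSg : Sg.PosDef)
    (Q : Fin N → Matrix (Fin d) (Fin d) ℝ) (hQ : ∀ i, (Q i).PosDef)
    (R : Fin N → Matrix (Fin k) (Fin k) ℝ) (hR : ∀ i, (R i).PosDef)
    (α : ℝ) (hα : 0 < α)
    (K : Fin N → Matrix (Fin k) (Fin d) ℝ) (hK : MSS Pr A B K) (hKα : cost Pr A B Q R piv Sg K ≤ α)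
    (G : Fin N → Matrix (Fin k) (Fin d) ℝ)
    (hG : ∀ E : Fin N → Matrix (Fin k) (Fin d) ℝ, fderiv ℝ (cost Pr A B Q R piv Sg) K E = ip G E)
    (η : ℝ) (hη0 : 0 < η) (hη : η ≤ 1 / Lsm B R Q piv Sg α)
    (Ks : Fin N → Matrix (Fin k) (Fin d) ℝ) (hKs : MSS Pr A B Ks)
    (hopt : ∀ K' : Fin N → Matrix (Fin k) (Fin d) ℝ, MSS Pr A B K' → cost Pr A B Q R piv Sg Ks ≤ cost Pr A B Q R piv Sg K') :
    cost Pr A B Q R piv Sg (K - η • G) - cost Pr A B Q R piv Sg Ks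
      ≤ (1 - 2 * mu piv Sg ^ 2 * lamMin R * η / maxNorm (XK Pr piv Sg (Gam A B Ks)))
          * (cost Pr A B Q R piv Sg K - cost Pr A B Q R piv Sg Ks) := by
  exact main_aux ⟨hd, hk, hN, hPr, hPrSum, hpiv, hSg, hQ, hR⟩ hK hKα hG hη0 hη hKs

end MJLS
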